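/- Let (T,m) be a Noetherian local ring of dimension d ≥ 2, let R = T[x_1,…,x_n] be a polynomial ring in n ≥ 1 variables over T, graded by deg T = 0 and deg x_i = 1, let I = (x_1,…,x_n)R, and let P = m + I be the homogeneous maximal ideal of R. Let f ∈ R be a homogeneous polynomial whose nonzero coefficients form a system of parameters for T (i.e., there are exactly d nonzero coefficients and the ideal of T they generate is m-primary). Then the *socle of H^n_I(R/fR), namely Hom_R(R/P, H^n_I(R/fR)), is not a finitely generated R-module. -/

import Mathlib

section

open CategoryTheory Limits

section

universe v u v' u'

namespace ChainComplex
variable {D : Type u'} [Category.{v'} D] [Abelian D]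

lemma isIso_pOpcycles_of_d_eq_zero (K : ChainComplex D ℕ) (n : ℕ) (h : K.d (n + 1) n = 0) :
    IsIso (K.pOpcycles n) :=
  K.isIso_pOpcycles (n + 1) n (by simp) h

/-- The inclusion of homology into the chains when the incoming differential vanishes. -/
noncomputable def homologyTopι (K : ChainComplex D ℕ) (n : ℕ) (h : K.d (n + 1) n = 0) :
    K.homology n ⟶ K.X n :=
  have := K.isIso_pOpcycles_of_d_eq_zero n h
  K.homologyι n ≫ inv (K.pOpcycles n)

variable (K : ChainComplex D ℕ) (n : ℕ)

lemma homologyTopι_comp (h : K.d (n + 2) (n + 1) = 0) :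
    K.homologyTopι (n + 1) h ≫ K.d (n + 1) n = 0 := by
  have := K.isIso_pOpcycles_of_d_eq_zero (n + 1) h
  rw [homologyTopι, Category.assoc, ← K.p_fromOpcycles, IsIso.inv_hom_id_assoc,
    K.homologyι_comp_fromOpcycles]

lemma mono_homologyTopι (h : K.d (n + 1) n = 0) : Mono (K.homologyTopι n h) := by
  have := K.isIso_pOpcycles_of_d_eq_zero n h
  rw [homologyTopι]
  infer_instance

lemma homologyTopι_exact (h : K.d (n + 2) (n + 1) = 0) :
    (ShortComplex.mk _ _ (K.homologyTopι_comp n h)).Exact := by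
  have := K.isIso_pOpcycles_of_d_eq_zero (n + 1) h
  let S₁ := ShortComplex.mk (K.homologyι (n+1)) (K.fromOpcycles (n+1) n)
    (K.homologyι_comp_fromOpcycles _ _)
  have h2 : S₁.Exact :=
    ShortComplex.exact_of_f_is_kernel S₁ (K.homologyIsKernel (n+1) n (by simp))
  let e : S₁ ≅ ShortComplex.mk _ _ (K.homologyTopι_comp n h) :=
    ShortComplex.isoMk (Iso.refl _) (asIso (K.pOpcycles (n+1))).symm (Iso.refl _)
      (by simp [homologyTopι, S₁]) (by simp [S₁])
  exact ShortComplex.exact_of_iso e h2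

lemma homologyTopι_naturality {K L : ChainComplex D ℕ} (φ : K ⟶ L) (n : ℕ)
    (hK : K.d (n + 1) n = 0) (hL : L.d (n + 1) n = 0) :
    HomologicalComplex.homologyMap φ n ≫ L.homologyTopι n hL =
      K.homologyTopι n hK ≫ φ.f n := by
  have := K.isIso_pOpcycles_of_d_eq_zero n hK
  have := L.isIso_pOpcycles_of_d_eq_zero n hL
  rw [homologyTopι, homologyTopι, HomologicalComplex.homologyι_naturality_assoc, Category.assoc]
  congr 1
  rw [IsIso.comp_inv_eq, Category.assoc, IsIso.eq_inv_comp, HomologicalComplex.p_opcyclesMap]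

end ChainComplex

namespace CategoryTheory.ProjectiveResolution
variable {C : Type u} [Category.{v} C] [Abelian C]
  {D : Type u'} [Category.{v'} D] [Abelian D]

lemma map_d_eq_zero {X : C} (P : ProjectiveResolution X) (F : C ⥤ D) [F.Additive]
    {n : ℕ} (h : P.complex.d (n + 1) n = 0) :
    ((F.mapHomologicalComplex _).obj P.complex).d (n + 1) n = 0 :=
  (congrArg F.map h).trans (F.map_zero _ _)

variable [HasProjectiveResolutions C]

/-- The inclusion of the top left derived functor when the next differential vanishes. -/
noncomputable def leftDerivedTopι {X : C} (P : ProjectiveResolution X) (F : C ⥤ D) [F.Additive]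
    (n : ℕ) (h : P.complex.d (n + 1) n = 0) :
    (F.leftDerived n).obj X ⟶ F.obj (P.complex.X n) :=
  (P.isoLeftDerivedObj F n).hom ≫ ChainComplex.homologyTopι _ n (P.map_d_eq_zero F h)

lemma leftDerivedTopι_comp {X : C} (P : ProjectiveResolution X) (F : C ⥤ D) [F.Additive]
    (n : ℕ) (h : P.complex.d (n + 2) (n + 1) = 0) :
    P.leftDerivedTopι F (n + 1) h ≫ F.map (P.complex.d (n + 1) n) = 0 := by
  refine (Category.assoc _ _ _).trans ?_
  exact (congrArg _ (ChainComplex.homologyTopι_comp _ n (P.map_d_eq_zero F h))).trans comp_zero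

lemma mono_leftDerivedTopι {X : C} (P : ProjectiveResolution X) (F : C ⥤ D) [F.Additive]
    (n : ℕ) (h : P.complex.d (n + 1) n = 0) : Mono (P.leftDerivedTopι F n h) := by
  have := ChainComplex.mono_homologyTopι _ n (P.map_d_eq_zero F h)
  exact @mono_comp _ _ _ _ _ _ inferInstance _ this

lemma leftDerivedTopι_exact {X : C} (P : ProjectiveResolution X) (F : C ⥤ D) [F.Additive]
    (n : ℕ) (h : P.complex.d (n + 2) (n + 1) = 0) :
    (ShortComplex.mk _ _ (P.leftDerivedTopι_comp F n h)).Exact := by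
  let e : ShortComplex.mk _ _ (ChainComplex.homologyTopι_comp _ n (P.map_d_eq_zero F h)) ≅
      ShortComplex.mk _ _ (P.leftDerivedTopι_comp F n h) :=
    ShortComplex.isoMk (P.isoLeftDerivedObj F (n+1)).symm (Iso.refl _) (Iso.refl _)
      ((Iso.inv_hom_id_assoc _ _).trans (Category.comp_id _).symm)
      ((Category.id_comp _).trans (Category.comp_id _).symm)
  exact ShortComplex.exact_of_iso e
    (ChainComplex.homologyTopι_exact _ n (P.map_d_eq_zero F h))

lemma leftDerivedTopι_naturality {X Y : C} (f : X ⟶ Y) (P : ProjectiveResolution X)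
    (Q : ProjectiveResolution Y) (φ : P.complex ⟶ Q.complex)
    (comm : φ.f 0 ≫ Q.π.f 0 = P.π.f 0 ≫ f) (F : C ⥤ D) [F.Additive]
    (n : ℕ) (hP : P.complex.d (n + 1) n = 0) (hQ : Q.complex.d (n + 1) n = 0) :
    (F.leftDerived n).map f ≫ Q.leftDerivedTopι F n hQ =
      P.leftDerivedTopι F n hP ≫ F.map (φ.f n) := by
  have h := ChainComplex.homologyTopι_naturality ((F.mapHomologicalComplex _).map φ) n
    (P.map_d_eq_zero F hP) (Q.map_d_eq_zero F hQ)
  refine (isoLeftDerivedObj_hom_naturality_assoc f P Q φ comm F n _).trans ?_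
  exact (congrArg ((P.isoLeftDerivedObj F n).hom ≫ ·) h).trans (Category.assoc _ _ _).symm

end CategoryTheory.ProjectiveResolution
end

section

open Opposite
variable {R : Type} [CommRing R]

/-- The class in the top `Ext` module of a cochain on the last term of a resolution. -/
noncomputable def extTopClass {X : ModuleCat.{0} R} (P : ProjectiveResolution X)
    (n : ℕ) (h : P.complex.d (n + 1) n = 0) (M : ModuleCat.{0} R) :
    (P.complex.X n ⟶ M) →ₗ[R] ((Ext R (ModuleCat.{0} R) n).obj (op X)).obj M :=
  (P.leftDerivedTopι ((linearYoneda R (ModuleCat.{0} R)).obj M).rightOp n h).unop.hom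

lemma extTopClass_surjective {X : ModuleCat.{0} R} (P : ProjectiveResolution X)
    (n : ℕ) (h : P.complex.d (n + 2) (n + 1) = 0) (M : ModuleCat.{0} R) :
    Function.Surjective (extTopClass P (n + 1) h M) := by
  have := P.mono_leftDerivedTopι ((linearYoneda R (ModuleCat.{0} R)).obj M).rightOp (n + 1) h
  exact (ModuleCat.epi_iff_surjective _).1 (inferInstance : Epi (P.leftDerivedTopι
    ((linearYoneda R (ModuleCat.{0} R)).obj M).rightOp (n + 1) h).unop)

lemma extTopClass_eq_zero_iff {X : ModuleCat.{0} R} (P : ProjectiveResolution X)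
    (n : ℕ) (h : P.complex.d (n + 2) (n + 1) = 0) (M : ModuleCat.{0} R)
    (ψ : P.complex.X (n + 1) ⟶ M) :
    extTopClass P (n + 1) h M ψ = 0 ↔
      ∃ χ : P.complex.X n ⟶ M, P.complex.d (n + 1) n ≫ χ = ψ := by
  have h1 := P.leftDerivedTopι_exact ((linearYoneda R (ModuleCat.{0} R)).obj M).rightOp n h
  have h2 := (ShortComplex.moduleCat_exact_iff _).1 (ShortComplex.Exact.unop h1)
  constructor
  · intro hz
    exact h2 ψ hz
  · rintro ⟨χ, rfl⟩
    have h3 := (ShortComplex.mk _ _ (P.leftDerivedTopι_comp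
      ((linearYoneda R (ModuleCat.{0} R)).obj M).rightOp n h)).unop.zero
    exact ConcreteCategory.congr_hom h3 χ

lemma extTopClass_naturality {X Y : ModuleCat.{0} R} (f : X ⟶ Y) (P : ProjectiveResolution X)
    (Q : ProjectiveResolution Y) (φ : P.complex ⟶ Q.complex)
    (comm : φ.f 0 ≫ Q.π.f 0 = P.π.f 0 ≫ f)
    (n : ℕ) (hP : P.complex.d (n + 1) n = 0) (hQ : Q.complex.d (n + 1) n = 0)
    (M : ModuleCat.{0} R) (ψ : Q.complex.X n ⟶ M) :
    (((Ext R (ModuleCat.{0} R) n).map f.op).app M).hom (extTopClass Q n hQ M ψ) =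
      extTopClass P n hP M (φ.f n ≫ ψ) := by
  have := ProjectiveResolution.leftDerivedTopι_naturality f P Q φ comm
    ((linearYoneda R (ModuleCat.{0} R)).obj M).rightOp n hP hQ
  exact ConcreteCategory.congr_hom (congrArg Quiver.Hom.unop this) ψ
end

section

variable (R : Type) [CommRing R]

/-- A sequence of modules and maps `⋯ → X 2 → X 1 → X 0`. -/
structure ModuleSeq where
  X : ℕ → ModuleCat.{0} R
  d : ∀ i, X (i + 1) →ₗ[R] X i

variable {R}
namespace ModuleSeq

/-- The terms of the mapping cone of multiplication by a scalar. -/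
def coneX (C : ModuleSeq R) : ℕ → ModuleCat.{0} R
  | 0 => C.X 0
  | i + 1 => ModuleCat.of R (C.X (i + 1) × C.X i)

/-- The inclusion of a sequence in the cone. -/
def coneInl (C : ModuleSeq R) : ∀ i, C.X i →ₗ[R] C.coneX i
  | 0 => LinearMap.id
  | i + 1 => LinearMap.inl R (C.X (i + 1)) (C.X i)

/-- The shifted copy of a sequence in the cone. -/
def coneInr (C : ModuleSeq R) (i : ℕ) : C.X i →ₗ[R] C.coneX (i + 1) :=
  LinearMap.inr R (C.X (i + 1)) (C.X i)

/-- A linear map from a positive term of the cone. -/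
def coneDesc (C : ModuleSeq R) {M : Type} [AddCommGroup M] [Module R M] (i : ℕ)
    (f : C.X (i + 1) →ₗ[R] M) (g : C.X i →ₗ[R] M) : C.coneX (i + 1) →ₗ[R] M :=
  LinearMap.coprod f g

variable (C : ModuleSeq R)

@[simp] lemma coneDesc_inl {M : Type} [AddCommGroup M] [Module R M] (i : ℕ)
    (f : C.X (i + 1) →ₗ[R] M) (g : C.X i →ₗ[R] M) (a : C.X (i + 1)) :
    C.coneDesc i f g (C.coneInl (i + 1) a) = f a :=
  (congrArg (f a + ·) (map_zero g)).trans (add_zero _)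

@[simp] lemma coneDesc_inr {M : Type} [AddCommGroup M] [Module R M] (i : ℕ)
    (f : C.X (i + 1) →ₗ[R] M) (g : C.X i →ₗ[R] M) (b : C.X i) :
    C.coneDesc i f g (C.coneInr i b) = g b :=
  (congrArg (· + g b) (map_zero f)).trans (zero_add _)

lemma exists_cone_eq (i : ℕ) (x : C.coneX (i + 1)) :
    ∃ a b, x = C.coneInl (i + 1) a + C.coneInr i b := by
  obtain ⟨a, b⟩ := x
  refine ⟨a, b, ?_⟩
  exact (congrArg₂ Prod.mk (add_zero a).symm (zero_add b).symm :
    ((a, b) : C.X (i + 1) × C.X i) = (a + 0, 0 + b))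

lemma cone_eq_zero {i : ℕ} {a : C.X (i + 1)} {b : C.X i}
    (h : C.coneInl (i + 1) a + C.coneInr i b = 0) : a = 0 ∧ b = 0 := by
  have h1 := congrArg (C.coneDesc i LinearMap.id 0) h
  have h2 := congrArg (C.coneDesc i 0 LinearMap.id) h
  simp only [map_add, coneDesc_inl, coneDesc_inr, map_zero] at h1 h2
  simpa using And.intro h1 h2

/-- The mapping cone of multiplication by a scalar. -/
abbrev cone (y : R) : ModuleSeq R where
  X := C.coneX
  d
  | 0 => C.coneDesc 0 (C.d 0) (y • LinearMap.id)
  | i + 1 => C.coneDesc (i + 1) (C.coneInl (i + 1) ∘ₗ C.d (i + 1))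
      (y • C.coneInl (i + 1) - C.coneInr i ∘ₗ C.d i)

lemma cone_d_inl (y : R) (i : ℕ) (a : C.X (i + 1)) :
    (C.cone y).d i (C.coneInl (i + 1) a) = C.coneInl i (C.d i a) := by
  cases i with
  | zero => exact C.coneDesc_inl 0 _ _ a
  | succ i => exact C.coneDesc_inl (i + 1) _ _ a

lemma cone_d_inr_zero (y : R) (b : C.X 0) :
    (C.cone y).d 0 (C.coneInr 0 b) = y • C.coneInl 0 b :=
  C.coneDesc_inr 0 _ _ b

lemma cone_d_inr_succ (y : R) (i : ℕ) (b : C.X (i + 1)) :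
    (C.cone y).d (i + 1) (C.coneInr (i + 1) b) =
      y • C.coneInl (i + 1) b - C.coneInr i (C.d i b) :=
  C.coneDesc_inr (i + 1) _ _ b

/-- Consecutive maps compose to zero. -/
def IsComplex : Prop := ∀ i x, C.d i (C.d (i + 1) x) = 0

/-- Exactness in positive degrees. -/
def IsAcyclic : Prop := ∀ i x, C.d i x = 0 → ∃ z, C.d (i + 1) z = x

variable {C}

lemma IsComplex.cone (h : C.IsComplex) (y : R) : (C.cone y).IsComplex := by
  intro i x
  obtain ⟨a, b, rfl⟩ := C.exists_cone_eq (i + 1) x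
  have h1 : (C.cone y).d i ((C.cone y).d (i + 1) (C.coneInl (i + 2) a)) = 0 := by
    refine (congrArg _ (C.cone_d_inl y (i + 1) a)).trans ?_
    refine (C.cone_d_inl y i _).trans ?_
    rw [h, map_zero]
  have h2 : (C.cone y).d i ((C.cone y).d (i + 1) (C.coneInr (i + 1) b)) = 0 := by
    refine (congrArg _ (C.cone_d_inr_succ y i b)).trans ?_
    refine (map_sub ((C.cone y).d i) (y • C.coneInl (i + 1) b) (C.coneInr i (C.d i b))).trans ?_
    have h3 : (C.cone y).d i (y • C.coneInl (i + 1) b) = y • C.coneInl i (C.d i b) :=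
      (map_smul _ _ _).trans (congrArg (y • ·) (C.cone_d_inl y i b))
    have h4 : (C.cone y).d i (C.coneInr i (C.d i b)) = y • C.coneInl i (C.d i b) := by
      cases i with
      | zero => exact C.cone_d_inr_zero y _
      | succ i =>
        refine (C.cone_d_inr_succ y i _).trans ?_
        rw [h, map_zero, sub_zero]
    rw [h3, h4, sub_self]
  refine (congrArg _ (map_add ((C.cone y).d (i + 1)) (C.coneInl (i + 2) a)
    (C.coneInr (i + 1) b))).trans ?_
  rw [map_add, h1, h2, add_zero]

lemma cone_d_apply_succ (y : R) (i : ℕ) (a : C.X (i + 2)) (b : C.X (i + 1)) :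
    (C.cone y).d (i + 1) (C.coneInl (i + 2) a + C.coneInr (i + 1) b) =
      C.coneInl (i + 1) (C.d (i + 1) a + y • b) + C.coneInr i (- C.d i b) := by
  refine (map_add ((C.cone y).d (i + 1)) _ _).trans ?_
  refine (congrArg₂ (· + ·) (C.cone_d_inl y (i + 1) a) (C.cone_d_inr_succ y i b)).trans ?_
  rw [map_add, map_smul, map_neg]
  exact (add_sub_assoc _ _ _).symm.trans (sub_eq_add_neg _ _)

lemma cone_d_apply_zero (y : R) (a : C.X 1) (b : C.X 0) :
    (C.cone y).d 0 (C.coneInl 1 a + C.coneInr 0 b) = C.coneInl 0 (C.d 0 a + y • b) := by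
  refine (map_add ((C.cone y).d 0) _ _).trans ?_
  refine (congrArg₂ (· + ·) (C.cone_d_inl y 0 a) (C.cone_d_inr_zero y b)).trans ?_
  rw [map_add, map_smul]

lemma IsAcyclic.cone (h : C.IsAcyclic) {y : R}
    (hy : ∀ x : C.X 0, (∃ z, C.d 0 z = y • x) → ∃ z, C.d 0 z = x) : (C.cone y).IsAcyclic := by
  have key : ∀ i (a : C.X (i + 1)) (b : C.X i) (b' : C.X (i + 1)), C.d i b' = b →
      C.d i a + y • b = 0 →
      ∃ z, (C.cone y).d (i + 1) z = C.coneInl (i + 1) a + C.coneInr i b := by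
    rintro i a b b' rfl hab
    rw [← map_smul, ← map_add] at hab
    obtain ⟨a', ha'⟩ := h i _ hab
    refine ⟨C.coneInl (i + 2) a' + C.coneInr (i + 1) (-b'), ?_⟩
    refine (C.cone_d_apply_succ y i a' (-b')).trans ?_
    rw [ha', smul_neg, add_neg_cancel_right, map_neg (C.d i), neg_neg]
  intro i x hx
  obtain ⟨a, b, rfl⟩ := C.exists_cone_eq i x
  cases i with
  | zero =>
    have h1 : C.d 0 a + y • b = 0 := (C.cone_d_apply_zero y a b).symm.trans hx
    obtain ⟨b', hb'⟩ := hy b ⟨-a, by rw [map_neg, eq_comm, ← add_eq_zero_iff_eq_neg', h1]⟩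
    exact key 0 a b b' hb' h1
  | succ i =>
    obtain ⟨h1, h2⟩ := C.cone_eq_zero ((C.cone_d_apply_succ y i a b).symm.trans hx)
    obtain ⟨b', hb'⟩ := h i b (neg_eq_zero.1 h2)
    exact key (i + 1) a b b' hb' h1

lemma cone_free (h : ∀ i, Module.Free R (C.X i)) (y : R) (i : ℕ) :
    Module.Free R ((C.cone y).X i) := by
  cases i with
  | zero => exact h 0
  | succ i =>
    have := h i
    have := h (i + 1)
    exact (inferInstance : Module.Free R (C.X (i + 1) × C.X i))

/-- Maps of sequences. -/
structure Map (C D : ModuleSeq R) where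
  f : ∀ i, C.X i →ₗ[R] D.X i
  comm : ∀ i x, f i (C.d i x) = D.d i (f (i + 1) x)

/-- The components of `Map.cone`. -/
def Map.coneF {D : ModuleSeq R} (φ : Map C D) (u : R) : ∀ i, C.coneX i →ₗ[R] D.coneX i
  | 0 => φ.f 0
  | i + 1 => C.coneDesc i (D.coneInl (i + 1) ∘ₗ φ.f (i + 1)) (u • D.coneInr i ∘ₗ φ.f i)

lemma Map.coneF_inl {D : ModuleSeq R} (φ : Map C D) (u : R) (i : ℕ) (a : C.X i) :
    φ.coneF u i (C.coneInl i a) = D.coneInl i (φ.f i a) := by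
  cases i with
  | zero => rfl
  | succ i => exact C.coneDesc_inl i _ _ a

lemma Map.coneF_inr {D : ModuleSeq R} (φ : Map C D) (u : R) (i : ℕ) (a : C.X i) :
    φ.coneF u (i + 1) (C.coneInr i a) = u • D.coneInr i (φ.f i a) :=
  C.coneDesc_inr i _ _ a

/-- The map of cones of `u * y` and `y` induced by multiplication by `u`. -/
def Map.cone {D : ModuleSeq R} (φ : Map C D) {u y y' : R} (hy : y' = u * y) :
    Map (C.cone y') (D.cone y) where
  f := φ.coneF u
  comm i x := by
    obtain ⟨a, b, rfl⟩ := C.exists_cone_eq i x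
    have h1 : φ.coneF u (i + 1) (C.coneInl (i + 1) a + C.coneInr i b) =
        D.coneInl (i + 1) (φ.f (i + 1) a) + D.coneInr i (u • φ.f i b) := by
      rw [map_add, φ.coneF_inl, φ.coneF_inr, map_smul]
    rw [h1]
    cases i with
    | zero =>
      refine (congrArg (φ.coneF u 0) (C.cone_d_apply_zero y' a b)).trans ?_
      refine Eq.trans ?_ (D.cone_d_apply_zero y _ _).symm
      rw [φ.coneF_inl, map_add, map_smul, φ.comm, hy, smul_smul, mul_comm]
    | succ i =>
      refine (congrArg (φ.coneF u (i + 1)) (C.cone_d_apply_succ y' i a b)).trans ?_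
      refine Eq.trans ?_ (D.cone_d_apply_succ y i _ _).symm
      rw [map_add, φ.coneF_inl, φ.coneF_inr, map_add, map_smul, φ.comm, hy, smul_smul, mul_comm u y,
        map_neg, φ.comm, map_smul, ← smul_neg, map_smul]

end ModuleSeq
end

section

variable {R : Type} [CommRing R]

namespace ModuleSeq

/-- The Koszul complex of the first `k` terms of a sequence. -/
noncomputable def koszul (y : ℕ → R) : ℕ → ModuleSeq R
  | 0 =>
    { X := fun i => Nat.casesOn i (ModuleCat.of R R) (fun _ => ModuleCat.of R PUnit)
      d := fun _ => 0 }
  | k + 1 => (koszul y k).cone (y k)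

variable (y : ℕ → R)

lemma koszul_isComplex (k : ℕ) : (koszul y k).IsComplex := by
  induction k with
  | zero => intro i x; rfl
  | succ k ih => exact ih.cone _

lemma koszul_free (k i : ℕ) : Module.Free R ((koszul y k).X i) := by
  induction k generalizing i with
  | zero =>
    cases i with
    | zero => exact (inferInstance : Module.Free R R)
    | succ i => exact (inferInstance : Module.Free R PUnit)
  | succ k ih => exact cone_free ih _ i

lemma koszul_subsingleton (k i : ℕ) (h : k < i) : Subsingleton ((koszul y k).X i) := by
  induction k generalizing i with
  | zero =>
    cases i with
    | zero => exact absurd h (lt_irrefl 0)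
    | succ i => exact (inferInstance : Subsingleton PUnit)
  | succ k ih =>
    cases i with
    | zero => exact absurd h (Nat.not_lt_zero _)
    | succ i =>
      have := ih i (by omega)
      have := ih (i + 1) (by omega)
      exact (inferInstance : Subsingleton ((koszul y k).X (i + 1) × (koszul y k).X i))

/-- The identification of the degree zero term of the Koszul complex with the ring. -/
noncomputable def koszulZero : ∀ k, (koszul y k).X 0 ≃ₗ[R] R
  | 0 => LinearEquiv.refl R R
  | k + 1 => koszulZero k

/-- The generator of the top term of the Koszul complex. -/
noncomputable def koszulTop : ∀ k, (koszul y k).X k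
  | 0 => (1 : R)
  | k + 1 => (koszul y k).coneInr k (koszulTop k)

/-- The coordinate on the top term of the Koszul complex. -/
noncomputable def koszulTopCoord : ∀ k, (koszul y k).X k →ₗ[R] R
  | 0 => LinearMap.id
  | k + 1 => (koszul y k).coneDesc k 0 (koszulTopCoord k)

lemma koszulTopCoord_top (k : ℕ) : koszulTopCoord y k (koszulTop y k) = 1 := by
  induction k with
  | zero => rfl
  | succ k ih => exact ((koszul y k).coneDesc_inr k _ _ _).trans ih

lemma koszulTopCoord_smul_top (k : ℕ) (x : (koszul y k).X k) :
    koszulTopCoord y k x • koszulTop y k = x := by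
  induction k with
  | zero => exact mul_one (M := R) x
  | succ k ih =>
    obtain ⟨a, b, rfl⟩ := (koszul y k).exists_cone_eq k x
    have := koszul_subsingleton y k (k + 1) (by omega)
    obtain rfl : a = 0 := Subsingleton.elim _ _
    rw [map_zero, zero_add]
    have h1 : koszulTopCoord y (k + 1) ((koszul y k).coneInr k b) = koszulTopCoord y k b :=
      (koszul y k).coneDesc_inr k _ _ _
    rw [h1]
    exact (map_smul _ _ _).symm.trans (congrArg _ (ih b))

lemma koszul_range (k : ℕ) (r : R) :
    (∃ z, koszulZero y k ((koszul y k).d 0 z) = r) ↔ r ∈ Ideal.span (y '' Set.Iio k) := by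
  induction k generalizing r with
  | zero =>
    have : (∃ z, koszulZero y 0 ((koszul y 0).d 0 z) = r) ↔ (0 : R) = r :=
      ⟨fun ⟨z, hz⟩ => hz, fun h => ⟨0, h⟩⟩
    rw [this]
    simp [eq_comm]
  | succ k ih =>
    have h0 : Set.Iio (k + 1) = insert k (Set.Iio k) := by
      ext i; simp only [Set.mem_Iio, Set.mem_insert_iff]; omega
    rw [h0, Set.image_insert_eq, Ideal.mem_span_insert]
    constructor
    · rintro ⟨z, rfl⟩
      obtain ⟨a, b, rfl⟩ := (koszul y k).exists_cone_eq 0 z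
      refine ⟨koszulZero y k b, koszulZero y k ((koszul y k).d 0 a), (ih _).1 ⟨a, rfl⟩, ?_⟩
      refine (congrArg (koszulZero y k) ((koszul y k).cone_d_apply_zero (y k) a b)).trans ?_
      refine (map_add (koszulZero y k) _ _).trans ?_
      rw [map_smul, add_comm, smul_eq_mul, mul_comm]
    · rintro ⟨b, z, hz, rfl⟩
      obtain ⟨a, rfl⟩ := (ih z).2 hz
      refine ⟨(koszul y k).coneInl 1 a + (koszul y k).coneInr 0 ((koszulZero y k).symm b), ?_⟩
      refine (congrArg (koszulZero y k) ((koszul y k).cone_d_apply_zero (y k) a _)).trans ?_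
      refine (map_add (koszulZero y k) _ _).trans ?_
      rw [map_smul, LinearEquiv.apply_symm_apply, add_comm, smul_eq_mul, mul_comm]

lemma koszul_isAcyclic (k : ℕ)
    (h : ∀ j < k, ∀ r, y j * r ∈ Ideal.span (y '' Set.Iio j) → r ∈ Ideal.span (y '' Set.Iio j)) :
    (koszul y k).IsAcyclic := by
  induction k with
  | zero => exact fun i x _ => ⟨0, (Subsingleton.elim (α := PUnit) _ _)⟩
  | succ k ih =>
    refine (ih fun j hj => h j (by omega)).cone ?_
    rintro x ⟨z, hz⟩
    obtain ⟨z', hz'⟩ := (koszul_range y k (koszulZero y k x)).2 (h k (by omega) _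
      ((koszul_range y k _).1 ⟨z, by rw [hz, map_smul, smul_eq_mul]⟩))
    exact ⟨z', (koszulZero y k).injective hz'⟩

lemma koszul_d_top_mem (k : ℕ) : (koszul y (k + 1)).d k (koszulTop y (k + 1)) ∈
    (Ideal.span (y '' Set.Iio (k + 1)) • ⊤ : Submodule R ((koszul y (k + 1)).X k)) := by
  have hy : ∀ k, y k ∈ Ideal.span (y '' Set.Iio (k + 1)) := fun k =>
    Ideal.subset_span ⟨k, Nat.lt_succ_self k, rfl⟩
  induction k with
  | zero =>
    have h1 : (koszul y 1).d 0 (koszulTop y 1) = y 0 • koszulTop y 0 :=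
      (koszul y 0).cone_d_inr_zero (y 0) _
    rw [h1]
    exact Submodule.smul_mem_smul (hy 0) (Submodule.mem_top (R := R) (M := (koszul y 1).X 0))
  | succ k ih =>
    have h1 : (koszul y (k + 2)).d (k + 1) (koszulTop y (k + 2)) =
        y (k + 1) • (koszul y (k + 1)).coneInl (k + 1) (koszulTop y (k + 1)) -
          (koszul y (k + 1)).coneInr k ((koszul y (k + 1)).d k (koszulTop y (k + 1))) :=
      (koszul y (k + 1)).cone_d_inr_succ _ _ _
    rw [h1]
    refine Submodule.sub_mem _ (Submodule.smul_mem_smul (hy (k + 1))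
      (Submodule.mem_top (R := R) (M := (koszul y (k + 2)).X (k + 1)))) ?_
    have h2 := Submodule.mem_map_of_mem (f := (koszul y (k + 1)).coneInr k) ih
    rw [Submodule.map_smul''] at h2
    refine Submodule.smul_mono (Ideal.span_mono (Set.image_mono ?_)) le_top h2
    intro i hi
    exact lt_trans hi (Nat.lt_succ_self _)

lemma exists_koszul_d_top {M : Type} [AddCommGroup M] [Module R M] (k : ℕ) (m : M)
    (hm : m ∈ (Ideal.span (y '' Set.Iio (k + 1)) • ⊤ : Submodule R M)) :
    ∃ χ : (koszul y (k + 1)).X k →ₗ[R] M,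
      χ ((koszul y (k + 1)).d k (koszulTop y (k + 1))) = m := by
  induction k generalizing m with
  | zero =>
    have h0 : Set.Iio (0 + 1) = {0} := by ext i; simp
    rw [h0, Set.image_singleton, Submodule.ideal_span_singleton_smul] at hm
    obtain ⟨m', -, rfl⟩ := hm
    have h1 : (koszul y 1).d 0 (koszulTop y 1) = y 0 • koszulTop y 0 :=
      (koszul y 0).cone_d_inr_zero (y 0) _
    refine ⟨(LinearMap.toSpanSingleton R M m' : R →ₗ[R] M), ?_⟩
    refine (congrArg _ h1).trans ?_
    exact (LinearMap.map_smul _ (y 0) (1 : R)).trans (congrArg _ (one_smul _ _))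
  | succ k ih =>
    have h0 : Set.Iio (k + 1 + 1) = insert (k + 1) (Set.Iio (k + 1)) := by
      ext i; simp only [Set.mem_Iio, Set.mem_insert_iff]; omega
    rw [h0, Set.image_insert_eq, Ideal.span_insert, Submodule.sup_smul,
      Submodule.ideal_span_singleton_smul, Submodule.mem_sup] at hm
    obtain ⟨_, ⟨m', -, rfl⟩, m'', hm'', rfl⟩ := hm
    obtain ⟨χ, hχ⟩ := ih m'' hm''
    have h1 : (koszul y (k + 2)).d (k + 1) (koszulTop y (k + 2)) =
        y (k + 1) • (koszul y (k + 1)).coneInl (k + 1) (koszulTop y (k + 1)) -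
          (koszul y (k + 1)).coneInr k ((koszul y (k + 1)).d k (koszulTop y (k + 1))) :=
      (koszul y (k + 1)).cone_d_inr_succ _ _ _
    let θ : (koszul y (k + 1)).coneX (k + 1) →ₗ[R] M := (koszul y (k + 1)).coneDesc k
      (LinearMap.toSpanSingleton R M m' ∘ₗ koszulTopCoord y (k + 1)) (-χ)
    refine ⟨θ, (congrArg θ h1).trans ((map_sub θ _ _).trans ?_)⟩
    rw [map_smul, coneDesc_inl, coneDesc_inr, LinearMap.comp_apply, koszulTopCoord_top,
      LinearMap.toSpanSingleton_apply, one_smul, LinearMap.neg_apply, hχ, sub_neg_eq_add]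
    rfl

/-- The chain map of Koszul complexes of `u * y` and `y`. -/
noncomputable def koszulMap (u y y' : ℕ → R) (h : ∀ j, y' j = u j * y j) :
    ∀ k, Map (koszul y' k) (koszul y k)
  | 0 => { f := fun _ => LinearMap.id, comm := fun _ _ => rfl }
  | k + 1 => (koszulMap u y y' h k).cone (h k)

lemma koszulMap_zero (u y y' : ℕ → R) (h : ∀ j, y' j = u j * y j) (k : ℕ)
    (x : (koszul y' k).X 0) :
    koszulZero y k ((koszulMap u y y' h k).f 0 x) = koszulZero y' k x := by
  induction k with
  | zero => rfl
  | succ k ih => exact ih x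

lemma koszulMap_top (u y y' : ℕ → R) (h : ∀ j, y' j = u j * y j) (k : ℕ) :
    (koszulMap u y y' h k).f k (koszulTop y' k) = (∏ j ∈ Finset.range k, u j) • koszulTop y k := by
  induction k with
  | zero => exact (one_smul R (1 : R)).symm
  | succ k ih =>
    refine ((koszulMap u y y' h k).coneF_inr (u k) k _).trans ?_
    rw [ih, map_smul, smul_smul, Finset.prod_range_succ, mul_comm]
    rfl

end ModuleSeq
end

section

variable {R : Type} [CommRing R]

namespace ModuleSeq
variable {C : ModuleSeq R}

/-- The chain complex associated with a sequence of modules. -/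
noncomputable def toChainComplex (C : ModuleSeq R) (h : C.IsComplex) :
    ChainComplex (ModuleCat.{0} R) ℕ :=
  ChainComplex.of C.X (fun i => ModuleCat.ofHom (C.d i))
    (fun i => by ext x; exact h i x)

lemma toChainComplex_d (h : C.IsComplex) (i : ℕ) :
    (C.toChainComplex h).d (i + 1) i = ModuleCat.ofHom (C.d i) :=
  ChainComplex.of_d C.X (fun i => ModuleCat.ofHom (C.d i)) i

/-- The projective resolution given by an acyclic complex of free modules. -/
noncomputable def resolution (h : C.IsComplex) (hac : C.IsAcyclic)
    (hfree : ∀ i, Module.Free R (C.X i)) {M : Type} [AddCommGroup M] [Module R M]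
    (ε : C.X 0 →ₗ[R] M) (hε : Function.Surjective ε) (hε0 : ∀ x, ε x = 0 ↔ ∃ z, C.d 0 z = x) :
    ProjectiveResolution (ModuleCat.of R M) where
  complex := C.toChainComplex h
  projective i := by
    have := hfree i
    exact (inferInstance : Projective (ModuleCat.of R (C.X i)))
  π := (ChainComplex.toSingle₀Equiv _ _).symm ⟨ModuleCat.ofHom ε, by
    rw [toChainComplex_d]
    ext x
    exact (hε0 _).2 ⟨x, rfl⟩⟩
  quasiIso := ⟨fun i => by
    cases i with
    | zero =>
      rw [ChainComplex.quasiIsoAt₀_iff, ShortComplex.quasiIso_iff_of_zeros']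
      · constructor
        · refine (ShortComplex.moduleCat_exact_iff _).2 ?_
          intro x hx
          obtain ⟨z, hz⟩ := (hε0 x).1 hx
          refine ⟨z, ?_⟩
          refine Eq.trans ?_ hz
          exact ConcreteCategory.congr_hom (toChainComplex_d h 0) z
        · exact (ModuleCat.epi_iff_surjective (ModuleCat.ofHom ε)).2 hε
      all_goals rfl
    | succ i =>
      rw [quasiIsoAt_iff_exactAt']
      · rw [HomologicalComplex.exactAt_iff' _ (i + 2) (i + 1) i (by simp) (by simp)]
        refine (ShortComplex.moduleCat_exact_iff _).2 ?_
        intro x hx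
        obtain ⟨z, hz⟩ := hac i x
          ((ConcreteCategory.congr_hom (toChainComplex_d h i) x).symm.trans hx)
        exact ⟨z, (ConcreteCategory.congr_hom (toChainComplex_d h (i + 1)) z).trans hz⟩
      · exact ChainComplex.exactAt_succ_single_obj _ _⟩

/-- The chain map associated with a map of sequences. -/
noncomputable def Map.toHom {D : ModuleSeq R} (φ : Map C D) (hC : C.IsComplex)
    (hD : D.IsComplex) : C.toChainComplex hC ⟶ D.toChainComplex hD :=
  ChainComplex.ofHom (fun i => ModuleCat.ofHom (φ.f i)) (fun i => by
    rw [toChainComplex_d, toChainComplex_d]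
    ext x
    exact (φ.comm i x).symm)

/-- Regularity of the first `k` terms of a sequence. -/
def IsRegularSeq (y : ℕ → R) (k : ℕ) : Prop :=
  ∀ j < k, ∀ r, y j * r ∈ Ideal.span (y '' Set.Iio j) → r ∈ Ideal.span (y '' Set.Iio j)

variable (y : ℕ → R) (k : ℕ)

/-- The augmentation of the Koszul complex. -/
noncomputable def koszulAug (J : Ideal R) : (koszul y k).X 0 →ₗ[R] R ⧸ J :=
  Submodule.mkQ J ∘ₗ (koszulZero y k).toLinearMap

/-- The Koszul resolution of the quotient by a regular sequence. -/
noncomputable def koszulResolution (h : IsRegularSeq y k) (J : Ideal R)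
    (hJ : J = Ideal.span (y '' Set.Iio k)) :
    ProjectiveResolution (ModuleCat.of R (R ⧸ J)) :=
  resolution (koszul_isComplex y k) (koszul_isAcyclic y k h) (koszul_free y k)
    (koszulAug y k J)
    ((Submodule.mkQ_surjective J).comp (koszulZero y k).surjective)
    (fun x => by
      have h1 : koszulAug y k J x = 0 ↔ koszulZero y k x ∈ J := Submodule.Quotient.mk_eq_zero J
      rw [h1, hJ, ← koszul_range]
      simp only [EmbeddingLike.apply_eq_iff_eq])

variable {y k} in
lemma koszulResolution_d_top (h : IsRegularSeq y k) (J : Ideal R)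
    (hJ : J = Ideal.span (y '' Set.Iio k)) :
    (koszulResolution y k h J hJ).complex.d (k + 1) k = 0 := by
  have := koszul_subsingleton y k (k + 1) (by omega)
  refine (toChainComplex_d (koszul_isComplex y k) k).trans ?_
  ext x
  obtain rfl : x = 0 := Subsingleton.elim (α := (koszul y k).X (k + 1)) _ _
  exact map_zero ((koszul y k).d k)

/-- The class in the top `Ext` module of an element of a module. -/
noncomputable def koszulExtClass (h : IsRegularSeq y (k + 1)) (J : Ideal R)
    (hJ : J = Ideal.span (y '' Set.Iio (k + 1))) (M : ModuleCat.{0} R) :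
    M →ₗ[R] ((Ext R (ModuleCat.{0} R) (k + 1)).obj (Opposite.op (ModuleCat.of R (R ⧸ J)))).obj M where
  toFun m := extTopClass (koszulResolution y (k + 1) h J hJ) (k + 1)
    (koszulResolution_d_top h J hJ) M
    (ModuleCat.ofHom (LinearMap.toSpanSingleton R M m ∘ₗ koszulTopCoord y (k + 1)))
  map_add' m m' := by
    refine Eq.trans (congrArg _ ?_) (map_add _ _ _)
    refine ModuleCat.hom_ext (LinearMap.ext fun x => ?_)
    exact smul_add (koszulTopCoord y (k + 1) x) m m'
  map_smul' r m := by
    refine Eq.trans (congrArg _ ?_) (map_smul _ _ _)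
    refine ModuleCat.hom_ext (LinearMap.ext fun x => ?_)
    exact smul_comm (koszulTopCoord y (k + 1) x) r m

variable {y k}

lemma koszulExtClass_surjective (h : IsRegularSeq y (k + 1)) (J : Ideal R)
    (hJ : J = Ideal.span (y '' Set.Iio (k + 1))) (M : ModuleCat.{0} R) :
    Function.Surjective (koszulExtClass y k h J hJ M) := by
  intro e
  obtain ⟨ψ, rfl⟩ := extTopClass_surjective (koszulResolution y (k + 1) h J hJ) k
    (koszulResolution_d_top h J hJ) M e
  let ψ' : (koszul y (k + 1)).X (k + 1) →ₗ[R] M := ψ.hom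
  refine ⟨ψ' (koszulTop y (k + 1)), ?_⟩
  refine congrArg (extTopClass (koszulResolution y (k + 1) h J hJ) (k + 1)
    (koszulResolution_d_top h J hJ) M) ?_
  refine ModuleCat.hom_ext (LinearMap.ext fun x => ?_)
  exact (map_smul ψ' _ _).symm.trans (congrArg ψ' (koszulTopCoord_smul_top y (k + 1) x))

lemma koszulExtClass_eq_zero_iff (h : IsRegularSeq y (k + 1)) (J : Ideal R)
    (hJ : J = Ideal.span (y '' Set.Iio (k + 1))) (M : ModuleCat.{0} R) (m : M) :
    koszulExtClass y k h J hJ M m = 0 ↔ m ∈ (J • ⊤ : Submodule R M) := by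
  refine (extTopClass_eq_zero_iff (koszulResolution y (k + 1) h J hJ) k
    (koszulResolution_d_top h J hJ) M _).trans ?_
  have hd := toChainComplex_d (koszul_isComplex y (k + 1)) k
  have h1 : ∀ χ : (koszulResolution y (k + 1) h J hJ).complex.X k ⟶ M,
      ((koszulResolution y (k + 1) h J hJ).complex.d (k + 1) k ≫ χ =
        ModuleCat.ofHom (LinearMap.toSpanSingleton R M m ∘ₗ koszulTopCoord y (k + 1))) ↔
      (χ.hom : (koszul y (k + 1)).X k →ₗ[R] M)
        ((koszul y (k + 1)).d k (koszulTop y (k + 1))) = m := by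
    intro χ
    let χ' : (koszul y (k + 1)).X k →ₗ[R] M := χ.hom
    constructor
    · intro h2
      have h3 := ConcreteCategory.congr_hom h2 (koszulTop y (k + 1))
      have h4 : koszulTopCoord y (k + 1) (koszulTop y (k + 1)) • m = m := by
        rw [koszulTopCoord_top, one_smul]
      refine Eq.trans ?_ (h3.trans h4)
      exact congrArg χ' (ConcreteCategory.congr_hom hd (koszulTop y (k + 1))).symm
    · intro h2
      refine (congrArg (· ≫ χ) hd).trans ?_
      refine ModuleCat.hom_ext (LinearMap.ext fun x => ?_)
      change χ' ((koszul y (k + 1)).d k x) = koszulTopCoord y (k + 1) x • m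
      rw [← h2]
      refine Eq.trans ?_ (map_smul χ' _ _)
      refine congrArg χ' (Eq.trans ?_ (map_smul ((koszul y (k + 1)).d k) _ _))
      exact congrArg ((koszul y (k + 1)).d k) (koszulTopCoord_smul_top y (k + 1) x).symm
  constructor
  · rintro ⟨χ, hχ⟩
    have h2 := (h1 χ).1 hχ
    let χ' : (koszul y (k + 1)).X k →ₗ[R] M := χ.hom
    have h3 := Submodule.mem_map_of_mem (f := χ') (koszul_d_top_mem y k)
    rw [Submodule.map_smul''] at h3
    rw [hJ]
    exact h2 ▸ Submodule.smul_mono le_rfl le_top h3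
  · intro hm
    obtain ⟨χ, hχ⟩ := exists_koszul_d_top y k m (hJ ▸ hm)
    exact ⟨ModuleCat.ofHom χ, (h1 _).2 hχ⟩

lemma koszulExtClass_naturality {u y y' : ℕ → R} (hu : ∀ j, y' j = u j * y j)
    (h : IsRegularSeq y (k + 1)) (h' : IsRegularSeq y' (k + 1)) (J J' : Ideal R)
    (hJ : J = Ideal.span (y '' Set.Iio (k + 1))) (hJ' : J' = Ideal.span (y' '' Set.Iio (k + 1)))
    (f : ModuleCat.of R (R ⧸ J') ⟶ ModuleCat.of R (R ⧸ J))
    (hf : ∀ r : R, f.hom (Submodule.Quotient.mk r) = Submodule.Quotient.mk r)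
    (M : ModuleCat.{0} R) (m : M) :
    (((Ext R (ModuleCat.{0} R) (k + 1)).map f.op).app M).hom (koszulExtClass y k h J hJ M m) =
      koszulExtClass y' k h' J' hJ' M ((∏ j ∈ Finset.range (k + 1), u j) • m) := by
  let P := koszulResolution y' (k + 1) h' J' hJ'
  let Q := koszulResolution y (k + 1) h J hJ
  let φ : P.complex ⟶ Q.complex := (koszulMap u y y' hu (k + 1)).toHom (koszul_isComplex _ _)
    (koszul_isComplex _ _)
  refine (extTopClass_naturality f P Q φ ?_ (k + 1) (koszulResolution_d_top h' J' hJ')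
    (koszulResolution_d_top h J hJ) M _).trans ?_
  · ext x
    change koszulAug y (k + 1) J ((koszulMap u y y' hu (k + 1)).f 0 x) =
      f.hom (koszulAug y' (k + 1) J' x)
    refine Eq.trans ?_ (hf _).symm
    exact congrArg (Submodule.Quotient.mk (p := J)) (koszulMap_zero u y y' hu (k + 1) x)
  · refine congrArg (extTopClass P (k + 1) (koszulResolution_d_top h' J' hJ') M) ?_
    refine ModuleCat.hom_ext (LinearMap.ext fun x => ?_)
    change koszulTopCoord y (k + 1) ((koszulMap u y y' hu (k + 1)).f (k + 1) x) • m =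
      koszulTopCoord y' (k + 1) x • (∏ j ∈ Finset.range (k + 1), u j) • m
    have h1 : (koszulMap u y y' hu (k + 1)).f (k + 1) x =
        koszulTopCoord y' (k + 1) x • (∏ j ∈ Finset.range (k + 1), u j) • koszulTop y (k + 1) :=
      (congrArg _ (koszulTopCoord_smul_top y' (k + 1) x).symm).trans
        ((map_smul _ _ _).trans (congrArg _ (koszulMap_top u y y' hu (k + 1))))
    rw [h1, map_smul, map_smul, koszulTopCoord_top, smul_eq_mul, smul_eq_mul, mul_one, mul_smul]

end ModuleSeq
end

section

open Opposite localCohomology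
variable {R : Type} [CommRing R]

/-- A descending sequence of ideals as a functor. -/
def idealSeqDiagram (G : ℕ → Ideal R) (hG : Antitone G) : ℕᵒᵖ ⥤ Ideal R where
  obj t := G (unop t)
  map w := ⟨⟨hG w.unop.down.down⟩⟩

/-- A descending sequence of ideals whose radicals contain `J` as a functor. -/
def idealSeqToSelfLERadical (G : ℕ → Ideal R) (hG : Antitone G) (J : Ideal R)
    (h : ∀ t, J ≤ (G t).radical) : ℕᵒᵖ ⥤ SelfLERadical J :=
  ObjectProperty.lift _ (idealSeqDiagram G hG) fun k => h (unop k)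

lemma idealSeqToSelfLERadical_initial (G : ℕ → Ideal R) (hG : Antitone G) (J : Ideal R)
    (h : ∀ t, J ≤ (G t).radical) (h' : ∀ J' : Ideal R, J ≤ J'.radical → ∃ k, G k ≤ J') :
    Functor.Initial (idealSeqToSelfLERadical G hG J h) where
  out J' := by
    apply +allowSynthFailures zigzag_isConnected
    · obtain ⟨k, hk⟩ := h' _ J'.2
      exact ⟨CostructuredArrow.mk
        (⟨⟨⟨hk⟩⟩⟩ : (idealSeqToSelfLERadical G hG J h).obj (op k) ⟶ J')⟩
    · intro j1 j2
      apply Relation.ReflTransGen.single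
      rcases le_total (unop j1.left) (unop j2.left) with h | h
      · right; exact ⟨CostructuredArrow.homMk (homOfLE h).op rfl⟩
      · left; exact ⟨CostructuredArrow.homMk (homOfLE h).op rfl⟩

/-- Local cohomology along a cofinal sequence of ideals. -/
noncomputable def localCohomologyIsoIdealSeq [IsNoetherianRing R] (G : ℕ → Ideal R)
    (hG : Antitone G) (J : Ideal R) (h : ∀ t, J ≤ (G t).radical)
    (h' : ∀ J' : Ideal R, J ≤ J'.radical → ∃ k, G k ≤ J') (i : ℕ) :
    ofDiagram.{0, 0} (idealSeqDiagram G hG) i ≅ localCohomology J i :=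
  have := idealSeqToSelfLERadical_initial G hG J h h'
  (HasColimit.isoOfNatIso.{0, 0, 1, 1} (Iso.refl _) ≪≫
    localCohomology.isoOfFinal.{0, 0, 0} (idealSeqToSelfLERadical G hG J h)
      (selfLERadicalDiagram J) i) ≪≫ isoSelfLERadical J i

lemma ModuleCat.exists_map_eq_zero_of_isColimit {D : Type} [SmallCategory D] [IsFiltered D]
    {F : D ⥤ ModuleCat.{0} R} {c : Cocone F} (hc : IsColimit c) {j : D} (x : F.obj j)
    (hx : (c.ι.app j).hom x = 0) : ∃ (k : D) (g : j ⟶ k), (F.map g).hom x = 0 := by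
  obtain ⟨u, f, g, hfg⟩ := Concrete.isColimit_exists_of_rep_eq F hc x (0 : F.obj j)
    (hx.trans (map_zero (c.ι.app j).hom).symm)
  exact ⟨u, f, hfg.trans (map_zero (F.map g).hom)⟩

lemma exists_localCohomology_desc [IsNoetherianRing R] (G : ℕ → Ideal R)
    (hG : Antitone G) (J : Ideal R) (h : ∀ t, J ≤ (G t).radical)
    (h' : ∀ J' : Ideal R, J ≤ J'.radical → ∃ k, G k ≤ J') (i : ℕ) (M : ModuleCat.{0} R) :
    ∃ ι : ∀ t, ((Ext R (ModuleCat.{0} R) i).obj (op (ModuleCat.of R (R ⧸ G t)))).obj M →ₗ[R]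
        (localCohomology J i).obj M,
      (∀ (s t : ℕ) (hst : s ≤ t) (e), ι t ((((Ext R (ModuleCat.{0} R) i).map
        ((ringModIdeals (idealSeqDiagram G hG)).map (homOfLE hst).op).op).app M).hom e) = ι s e) ∧
      (∀ z, ∃ t e, ι t e = z) ∧
      (∀ t e, ι t e = 0 → ∃ (u : ℕ) (hu : t ≤ u), (((Ext R (ModuleCat.{0} R) i).map
        ((ringModIdeals (idealSeqDiagram G hG)).map (homOfLE hu).op).op).app M).hom e = 0) := by
  let F := diagram (idealSeqDiagram G hG) i
  let c : Cocone F := colimit.cocone F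
  let hc : IsColimit c := colimit.isColimit F
  let ev : (ModuleCat.{0} R ⥤ ModuleCat.{0} R) ⥤ ModuleCat.{0} R := (evaluation _ _).obj M
  let hc' : IsColimit (ev.mapCocone c) := isColimitOfPreserves ev hc
  let e : (ev.mapCocone c).pt ≅ (localCohomology J i).obj M :=
    (localCohomologyIsoIdealSeq G hG J h h' i).app M
  let e' := e.toLinearEquiv
  refine ⟨fun t => e'.toLinearMap ∘ₗ ((ev.mapCocone c).ι.app (op (op t))).hom, ?_, ?_, ?_⟩
  · intro s t hst x
    refine congrArg e' ?_
    exact ConcreteCategory.congr_hom ((ev.mapCocone c).w (homOfLE hst).op.op) x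
  · intro z
    obtain ⟨t, y, hy⟩ := Concrete.isColimit_exists_rep (F ⋙ ev) hc' (e'.symm z)
    exact ⟨unop (unop t), y, (congrArg e' hy).trans (e'.apply_symm_apply z)⟩
  · intro t x hx
    let y : (F ⋙ ev).obj (op (op t)) := x
    have hy : ((ev.mapCocone c).ι.app (op (op t))).hom y = 0 := e'.map_eq_zero_iff.1 hx
    obtain ⟨u, f, hf⟩ := ModuleCat.exists_map_eq_zero_of_isColimit
      (F := F ⋙ ev) (c := ev.mapCocone c) (j := op (op t)) hc' y hy
    exact ⟨unop (unop u), f.unop.unop.down.down, hf⟩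
end

section

open MvPolynomial localCohomology
variable {T : Type} [CommRing T] {n : ℕ}

/-- The ideal generated by the `t`-th powers of the variables. -/
noncomputable def powIdeal (T : Type) [CommRing T] (n t : ℕ) : Ideal (MvPolynomial (Fin n) T) :=
  Ideal.span (Set.range fun i => (X i : MvPolynomial (Fin n) T) ^ t)

/-- The product of the variables. -/
noncomputable def prodX (T : Type) [CommRing T] (n : ℕ) : MvPolynomial (Fin n) T := ∏ i, X i

/-- The sequence of `t`-th powers of the variables, extended by `1`. -/
noncomputable def powSeq (T : Type) [CommRing T] (n t j : ℕ) : MvPolynomial (Fin n) T :=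
  if h : j < n then X ⟨j, h⟩ ^ t else 1

lemma powSeq_of_lt (t : ℕ) {j : ℕ} (h : j < n) : powSeq T n t j = X ⟨j, h⟩ ^ t := dif_pos h

lemma powSeq_fin (t : ℕ) (j : Fin n) : powSeq T n t j = X j ^ t := dif_pos j.2

lemma powIdeal_eq (t : ℕ) : powIdeal T n t = Ideal.span (powSeq T n t '' Set.Iio n) := by
  rw [powIdeal]
  congr 1
  ext r
  constructor
  · rintro ⟨i, rfl⟩
    exact ⟨i, i.2, powSeq_fin t i⟩
  · rintro ⟨j, hj, rfl⟩
    exact ⟨⟨j, hj⟩, (powSeq_of_lt t hj).symm⟩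

lemma powIdeal_antitone : Antitone (powIdeal T n) := by
  intro s t h
  rw [powIdeal, Ideal.span_le]
  rintro _ ⟨i, rfl⟩
  exact Ideal.mem_of_dvd _ (pow_dvd_pow _ h) (Ideal.subset_span ⟨i, rfl⟩)

lemma span_X_le_radical_powIdeal (t : ℕ) :
    Ideal.span (Set.range (X : Fin n → MvPolynomial (Fin n) T)) ≤ (powIdeal T n t).radical := by
  rw [Ideal.span_le]
  rintro _ ⟨i, rfl⟩
  exact ⟨t, Ideal.subset_span ⟨i, rfl⟩⟩

lemma exists_powIdeal_le (J : Ideal (MvPolynomial (Fin n) T))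
    (h : Ideal.span (Set.range X) ≤ J.radical) : ∃ k, powIdeal T n k ≤ J := by
  have h1 : ∀ i : Fin n, ∃ k, (X i : MvPolynomial (Fin n) T) ^ k ∈ J := fun i =>
    h (Ideal.subset_span ⟨i, rfl⟩)
  choose k hk using h1
  refine ⟨Finset.univ.sup k, ?_⟩
  rw [powIdeal, Ideal.span_le]
  rintro _ ⟨i, rfl⟩
  exact Ideal.mem_of_dvd _ (pow_dvd_pow _ (Finset.le_sup (Finset.mem_univ i))) (hk i)

lemma mem_span_powSeq_iff (t j : ℕ) (hj : j ≤ n) (r : MvPolynomial (Fin n) T) :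
    r ∈ Ideal.span (powSeq T n t '' Set.Iio j) ↔
      ∀ ν ∈ r.support, ∃ i : Fin n, (i : ℕ) < j ∧ t ≤ ν i := by
  have h1 : powSeq T n t '' Set.Iio j = (fun s => monomial s (1 : T)) ''
      {ν : Fin n →₀ ℕ | ∃ i : Fin n, (i : ℕ) < j ∧ ν = Finsupp.single i t} := by
    ext r
    constructor
    · rintro ⟨i, hi, rfl⟩
      refine ⟨_, ⟨⟨i, lt_of_lt_of_le hi hj⟩, hi, rfl⟩, ?_⟩
      rw [powSeq_of_lt t (lt_of_lt_of_le hi hj), X_pow_eq_monomial]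
    · rintro ⟨_, ⟨i, hi, rfl⟩, rfl⟩
      exact ⟨i, hi, by rw [powSeq_fin, X_pow_eq_monomial]⟩
  rw [h1, mem_ideal_span_monomial_image]
  refine forall₂_congr fun ν _ => ?_
  constructor
  · rintro ⟨_, ⟨i, hi, rfl⟩, h⟩
    exact ⟨i, hi, by simpa using h i⟩
  · rintro ⟨i, hi, h⟩
    exact ⟨_, ⟨i, hi, rfl⟩, by simpa using h⟩

lemma mem_powIdeal_iff (t : ℕ) (r : MvPolynomial (Fin n) T) :
    r ∈ powIdeal T n t ↔ ∀ ν ∈ r.support, ∃ i, t ≤ ν i := by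
  rw [powIdeal_eq, mem_span_powSeq_iff t n le_rfl]
  simp

lemma powSeq_isRegularSeq (t : ℕ) : ModuleSeq.IsRegularSeq (powSeq T n t) n := by
  intro j hj r hr
  rw [mem_span_powSeq_iff t j hj.le] at hr ⊢
  intro ν hν
  obtain ⟨i, hi, h⟩ := hr (Finsupp.single ⟨j, hj⟩ t + ν) (by
    rw [powSeq_of_lt t hj, X_pow_eq_monomial, mem_support_iff, coeff_monomial_mul, one_mul]
    exact mem_support_iff.1 hν)
  refine ⟨i, hi, ?_⟩
  rwa [Finsupp.add_apply, Finsupp.single_eq_of_ne, zero_add] at h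
  intro h1
  simp [h1] at hi

lemma exists_localCohomology_generators [IsNoetherianRing T] (hn : 1 ≤ n)
    (M : ModuleCat.{0} (MvPolynomial (Fin n) T)) :
    ∃ φ : ℕ → M →ₗ[MvPolynomial (Fin n) T]
        (localCohomology (Ideal.span (Set.range (X : Fin n → MvPolynomial (Fin n) T))) n).obj M,
      (∀ t s m, φ (t + s) (prodX T n ^ s • m) = φ t m) ∧ (∀ z, ∃ t m, φ t m = z) ∧
      ∀ t m, φ t m = 0 ↔ ∃ u, prodX T n ^ u • m ∈
        (powIdeal T n (t + u) • ⊤ : Submodule (MvPolynomial (Fin n) T) M) := by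
  obtain ⟨k, rfl⟩ : ∃ k, n = k + 1 := ⟨n - 1, by omega⟩
  obtain ⟨ι, hι1, hι2, hι3⟩ := exists_localCohomology_desc (powIdeal T (k + 1))
    powIdeal_antitone _ span_X_le_radical_powIdeal exists_powIdeal_le (k + 1) M
  let κ := fun t => ModuleSeq.koszulExtClass (powSeq T (k + 1) t) k (powSeq_isRegularSeq t)
    (powIdeal T (k + 1) t) (powIdeal_eq t) M
  have hnat : ∀ (t s : ℕ) (m : M), (((Ext (MvPolynomial (Fin (k + 1)) T)
      (ModuleCat.{0} (MvPolynomial (Fin (k + 1)) T)) (k + 1)).map ((ringModIdeals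
      (idealSeqDiagram _ powIdeal_antitone)).map (homOfLE (Nat.le_add_right t s)).op).op).app
        M).hom (κ t m) = κ (t + s) (prodX T (k + 1) ^ s • m) := by
    intro t s m
    have h1 : ∏ j ∈ Finset.range (k + 1), powSeq T (k + 1) s j = prodX T (k + 1) ^ s := by
      rw [Finset.prod_range, prodX, ← Finset.prod_pow]
      exact Finset.prod_congr rfl fun i _ => powSeq_fin s i
    rw [← h1]
    refine ModuleSeq.koszulExtClass_naturality (u := powSeq T (k + 1) s) ?_
      (powSeq_isRegularSeq t) (powSeq_isRegularSeq (t + s)) _ _ (powIdeal_eq t)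
      (powIdeal_eq (t + s)) _ (fun r => rfl) M m
    intro j
    unfold powSeq
    split_ifs
    · rw [← pow_add, add_comm s t]
    · rw [one_mul]
  have hnat' : ∀ t s m, ι (t + s) (κ (t + s) (prodX T (k + 1) ^ s • m)) = ι t (κ t m) := by
    intro t s m
    rw [← hnat]
    exact hι1 t (t + s) (Nat.le_add_right t s) _
  refine ⟨fun t => ι t ∘ₗ κ t, hnat', fun z => ?_, fun t m => ⟨fun h => ?_, fun ⟨u, hu⟩ => ?_⟩⟩
  · obtain ⟨t, e, rfl⟩ := hι2 z
    obtain ⟨m, rfl⟩ := ModuleSeq.koszulExtClass_surjective (powSeq_isRegularSeq t)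
      (powIdeal T (k + 1) t) (powIdeal_eq t) M e
    exact ⟨t, m, rfl⟩
  · obtain ⟨u, hu, h2⟩ := hι3 t _ h
    obtain ⟨s, rfl⟩ := Nat.exists_eq_add_of_le hu
    have h3 := (hnat t s m).symm.trans h2
    exact ⟨s, (ModuleSeq.koszulExtClass_eq_zero_iff _ _ _ M _).1 h3⟩
  · refine (hnat' t u m).symm.trans ?_
    exact (congrArg _ ((ModuleSeq.koszulExtClass_eq_zero_iff _ _ _ M _).2 hu)).trans (map_zero _)
end

section

open MvPolynomial
variable {T : Type} [CommRing T] {n : ℕ} {f : MvPolynomial (Fin n) T}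
  {N : Type} [AddCommGroup N] [Module (MvPolynomial (Fin n) T) N]

/-- The presentation of the top local cohomology module of `R ⧸ (f)` by inverse monomials:
`φ t g` stands for the class of `g / (x₁ ⋯ xₙ) ^ t`. -/
structure TopPresentation (f : MvPolynomial (Fin n) T) (N : Type) [AddCommGroup N]
    [Module (MvPolynomial (Fin n) T) N] where
  φ : ℕ → MvPolynomial (Fin n) T →ₗ[MvPolynomial (Fin n) T] N
  map_add_mul : ∀ t s g, φ (t + s) (prodX T n ^ s * g) = φ t g
  exists_rep : ∀ z, ∃ t g, φ t g = z
  eq_zero_iff : ∀ t g, φ t g = 0 ↔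
    ∃ u, prodX T n ^ u * g ∈ powIdeal T n (t + u) ⊔ Ideal.span {f}

lemma nonempty_topPresentation [IsNoetherianRing T] (hn : 1 ≤ n) (f : MvPolynomial (Fin n) T) :
    Nonempty (TopPresentation f ((localCohomology
      (Ideal.span (Set.range (X : Fin n → MvPolynomial (Fin n) T))) n).obj
      (ModuleCat.of _ (MvPolynomial (Fin n) T ⧸ Ideal.span {f})))) := by
  obtain ⟨φ, h1, h2, h3⟩ := exists_localCohomology_generators (T := T) hn
    (ModuleCat.of _ (MvPolynomial (Fin n) T ⧸ Ideal.span {f}))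
  refine ⟨⟨fun t => φ t ∘ₗ Submodule.mkQ (Ideal.span {f}), fun t s g => ?_, fun z => ?_,
    fun t g => ?_⟩⟩
  · exact h1 t s (Submodule.Quotient.mk g)
  · obtain ⟨t, m, rfl⟩ := h2 z
    obtain ⟨g, rfl⟩ := (Ideal.span {f}).mkQ_surjective m
    exact ⟨t, g, rfl⟩
  · refine (h3 t (Submodule.Quotient.mk g)).trans (exists_congr fun u => ?_)
    rw [Ideal.smul_top_eq_map, Submodule.restrictScalars_mem]
    exact Ideal.mem_quotient_iff_mem_sup (x := prodX T n ^ u * g)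

lemma sum_eq_of_isHomogeneous {g : MvPolynomial (Fin n) T} {e : ℕ} (hg : g.IsHomogeneous e)
    {ν : Fin n →₀ ℕ} (hν : ν ∈ g.support) : ∑ i, ν i = e := by
  rw [← Finsupp.degree_eq_sum, Finsupp.degree_eq_weight_one]
  exact hg (mem_support_iff.1 hν)

namespace TopPresentation
variable (Φ : TopPresentation f N)

lemma φ_mul (t : ℕ) (g h : MvPolynomial (Fin n) T) : Φ.φ t (g * h) = g • Φ.φ t h :=
  map_smul (Φ.φ t) g h

lemma φ_of_mem {t : ℕ} {g : MvPolynomial (Fin n) T} (h : g ∈ powIdeal T n t) : Φ.φ t g = 0 :=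
  (Φ.eq_zero_iff t g).2 ⟨0, by rw [pow_zero, one_mul]; exact Ideal.mem_sup_left h⟩

lemma φ_mul_self (t : ℕ) (g : MvPolynomial (Fin n) T) : Φ.φ t (g * f) = 0 :=
  (Φ.eq_zero_iff t _).2 ⟨0, by
    rw [pow_zero, one_mul]
    exact Ideal.mem_sup_right (Ideal.mul_mem_left _ _ (Ideal.mem_span_singleton_self f))⟩

lemma φ_monomial_eq_zero {t : ℕ} {ν : Fin n →₀ ℕ} {i : Fin n} (h : t ≤ ν i) (c : T) :
    Φ.φ t (monomial ν c) = 0 := by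
  refine Φ.φ_of_mem ((mem_powIdeal_iff t _).2 fun μ hμ => ⟨i, ?_⟩)
  rwa [Finset.mem_singleton.1 (support_monomial_subset hμ)]

lemma prodX_pow (u : ℕ) :
    prodX T n ^ u = monomial (Finsupp.equivFunOnFinite.symm fun _ => u) 1 := by
  rw [monomial_eq, C_1, one_mul, prodX, ← Finset.prod_pow, Finsupp.prod_fintype _ _ (by simp)]
  rfl

lemma prodX_pow_isHomogeneous (u : ℕ) : (prodX T n ^ u).IsHomogeneous (n * u) := by
  rw [mul_comm]
  have h : (prodX T n).IsHomogeneous n := by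
    rw [prodX]
    simpa using IsHomogeneous.prod Finset.univ (fun i => (X i : MvPolynomial (Fin n) T))
      (fun _ => 1) (fun i _ => isHomogeneous_X T i)
  simpa [mul_comm] using h.pow u

lemma homogeneousComponent_mul_of_isHomogeneous {g h : MvPolynomial (Fin n) T} {i : ℕ}
    (hg : g.IsHomogeneous i) (j : ℕ) :
    homogeneousComponent (i + j) (g * h) = g * homogeneousComponent j h :=
  let := gradedAlgebra (σ := Fin n) (R := T)
  have h1 (q : MvPolynomial (Fin n) T) (k : ℕ) :
      (DirectSum.decompose (homogeneousSubmodule (Fin n) T) q k : MvPolynomial (Fin n) T) =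
        homogeneousComponent k q := decomposition.decompose'_apply q k
  by
    rw [← h1, ← h1]
    exact DirectSum.coe_decompose_mul_add_of_left_mem (homogeneousSubmodule (Fin n) T) hg

lemma φ_homogeneousComponent {p : ℕ} (hf : f.IsHomogeneous p) {t : ℕ}
    {g : MvPolynomial (Fin n) T} (h : Φ.φ t g = 0) (e : ℕ) :
    Φ.φ t (homogeneousComponent e g) = 0 := by
  obtain ⟨u, hu⟩ := (Φ.eq_zero_iff t g).1 h
  refine (Φ.eq_zero_iff t _).2 ⟨u, ?_⟩
  let := gradedAlgebra (σ := Fin n) (R := T)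
  have h1 : (powIdeal T n (t + u) ⊔ Ideal.span {f}).IsHomogeneous
      (homogeneousSubmodule (Fin n) T) := by
    refine Ideal.IsHomogeneous.sup (Ideal.homogeneous_span _ _ ?_) (Ideal.homogeneous_span _ _ ?_)
    · rintro _ ⟨i, rfl⟩
      exact ⟨_, isHomogeneous_X_pow i (t + u)⟩
    · rintro _ rfl
      exact ⟨p, hf⟩
  rw [← homogeneousComponent_mul_of_isHomogeneous (prodX_pow_isHomogeneous u)]
  exact homogeneousComponent_mem_of_mem h1 hu _

lemma range_φ_mono {s t : ℕ} (h : s ≤ t) : LinearMap.range (Φ.φ s) ≤ LinearMap.range (Φ.φ t) := by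
  obtain ⟨u, rfl⟩ := Nat.exists_eq_add_of_le h
  rintro _ ⟨g, rfl⟩
  exact ⟨_, Φ.map_add_mul s u g⟩

lemma eq_prodX_pow_mul {ν : Fin n →₀ ℕ} {u : ℕ} (h : ∀ i, u ≤ ν i) (c : T) :
    ∃ μ, monomial ν c = prodX T n ^ u * monomial μ c := by
  refine ⟨ν - Finsupp.equivFunOnFinite.symm fun _ => u, ?_⟩
  rw [prodX_pow, monomial_mul, one_mul, add_tsub_cancel_of_le]
  intro i
  simpa using h i

lemma φ_mem_range {t e l : ℕ} {g : MvPolynomial (Fin n) T} (hg : g.IsHomogeneous e)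
    (h : n * t ≤ e + l) : Φ.φ t g ∈ LinearMap.range (Φ.φ l) := by
  rcases le_total t l with htl | htl
  · exact Φ.range_φ_mono htl ⟨g, rfl⟩
  rw [g.as_sum, map_sum]
  refine Submodule.sum_mem _ fun ν hν => ?_
  by_cases h1 : ∃ i, t ≤ ν i
  · obtain ⟨i, hi⟩ := h1
    rw [Φ.φ_monomial_eq_zero hi]
    exact Submodule.zero_mem _
  push Not at h1
  have h2 := sum_eq_of_isHomogeneous hg hν
  have h3 : ∀ i, t - l ≤ ν i := by
    intro i
    have h4 : ∑ j, (t - ν j) + ∑ j, ν j = n * t := by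
      rw [← Finset.sum_add_distrib, Finset.sum_congr rfl fun j _ => Nat.sub_add_cancel (h1 j).le]
      simp
    have h5 : t - ν i ≤ ∑ j, (t - ν j) := Finset.single_le_sum (f := fun j => t - ν j)
      (fun j _ => Nat.zero_le _) (Finset.mem_univ i)
    omega
  obtain ⟨μ, hμ⟩ := eq_prodX_pow_mul h3 (coeff ν g)
  refine ⟨monomial μ (coeff ν g), ?_⟩
  rw [hμ, ← Φ.map_add_mul l (t - l), Nat.add_sub_cancel' htl]

end TopPresentation

end

end

section

open MvPolynomial
variable {T : Type} [CommRing T] {n : ℕ} {f : MvPolynomial (Fin n) T}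
  {N : Type} [AddCommGroup N] [Module (MvPolynomial (Fin n) T) N]

namespace TopPresentation
variable (Φ : TopPresentation f N)

/-- The ideal of those scalars killing all classes `x ^ ν / (x₁ ⋯ xₙ) ^ t` with `|ν| = D`. -/
def killIdeal (t D : ℕ) : Ideal T where
  carrier := {c | ∀ ν : Fin n →₀ ℕ, ∑ i, ν i = D → Φ.φ t (monomial ν c) = 0}
  add_mem' ha hb ν hν := by rw [map_add, map_add, ha ν hν, hb ν hν, add_zero]
  zero_mem' ν _ := by rw [map_zero, map_zero]
  smul_mem' a c hc ν hν := by
    rw [smul_eq_mul, ← C_mul_monomial, φ_mul, hc ν hν, smul_zero]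

lemma coeff_mem_radical_killIdeal {p : ℕ} (hf : f.IsHomogeneous p) {l t D : ℕ} (hlt : l + p ≤ t)
    (hD : D + l = n * t) {α : Fin n →₀ ℕ} (hα : α ∈ f.support) {B : Ideal T}
    (hB : ∀ β ∈ f.support, MonomialOrder.lex.toSyn α < MonomialOrder.lex.toSyn β → coeff β f ∈ B)
    {K : ℕ} (hK : B ^ K ≤ Φ.killIdeal t D) : coeff α f ∈ (Φ.killIdeal t D).radical := by
  classical
  have key : ∀ j ≤ K, ∀ᶠ k in Filter.atTop, ∀ b ∈ B ^ j, coeff α f ^ k * b ∈ Φ.killIdeal t D := by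
    intro j hj
    induction hj using Nat.decreasingInduction with
    | self => exact Filter.Eventually.of_forall fun k b hb => Ideal.mul_mem_left _ _ (hK hb)
    | of_succ j hj ih =>
      have h1 : ∀ ν : Fin n →₀ ℕ, ∑ i, ν i = D → ∀ᶠ k in Filter.atTop, ∀ b ∈ B ^ j,
          Φ.φ t (monomial ν (coeff α f ^ k * b)) = 0 := by
        intro ν
        induction ν using (InvImage.wf (MonomialOrder.lex (σ := Fin n)).toSyn wellFounded_lt).induction with
        | _ ν ihν =>
        intro hν
        by_cases h1 : ∃ i, t ≤ ν i
        · obtain ⟨i, hi⟩ := h1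
          exact Filter.Eventually.of_forall fun k b _ => Φ.φ_monomial_eq_zero hi _
        push Not at h1
        have hαν : α ≤ ν := by
          intro i
          have h2 : ∑ j, (t - ν j) + ∑ j, ν j = n * t := by
            rw [← Finset.sum_add_distrib,
              Finset.sum_congr rfl fun j _ => Nat.sub_add_cancel (h1 j).le]
            simp
          have h3 : t - ν i ≤ ∑ j, (t - ν j) := Finset.single_le_sum (f := fun j => t - ν j)
            (fun j _ => Nat.zero_le _) (Finset.mem_univ i)
          have h4 : α i ≤ ∑ j, α j := Finset.single_le_sum
            (fun j _ => Nat.zero_le _) (Finset.mem_univ i)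
          have h5 := sum_eq_of_isHomogeneous hf hα
          omega
        obtain ⟨γ, rfl⟩ := exists_add_of_le hαν
        have hsum : ∀ β ∈ f.support, ∑ i, (γ + β) i = D := by
          intro β hβ
          have h2 := sum_eq_of_isHomogeneous hf hβ
          have h3 := sum_eq_of_isHomogeneous hf hα
          simp only [Finsupp.add_apply, Finset.sum_add_distrib] at hν ⊢
          omega
        have h2 : ∀ᶠ k in Filter.atTop, ∀ β ∈ f.support.erase α, ∀ b ∈ B ^ j,
            Φ.φ t (monomial (γ + β) (coeff α f ^ k * b * coeff β f)) = 0 := by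
          rw [Filter.eventually_all_finset]
          intro β hβ
          obtain ⟨hβα, hβ⟩ := Finset.mem_erase.1 hβ
          rcases lt_or_gt_of_ne (MonomialOrder.lex.toSyn.injective.ne hβα) with h | h
          · have h3 := ihν (γ + β) (by
              simpa [InvImage, add_comm α γ] using h) (hsum β hβ)
            filter_upwards [h3] with k hk b hb
            rw [mul_comm, ← C_mul_monomial, φ_mul, hk b hb, smul_zero]
          · filter_upwards [ih] with k hk b hb
            rw [mul_assoc]
            exact hk _ (by rw [pow_succ]; exact Ideal.mul_mem_mul hb (hB β hβ h)) _ (hsum β hβ)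
        have h3 : ∀ᶠ k in Filter.atTop, ∀ b ∈ B ^ j,
            Φ.φ t (monomial (α + γ) (coeff α f ^ (k + 1) * b)) = 0 := by
          filter_upwards [h2] with k hk b hb
          have h4 := Φ.φ_mul_self t (monomial γ (coeff α f ^ k * b))
          rw [congrArg (monomial γ (coeff α f ^ k * b) * ·) f.as_sum, Finset.mul_sum, map_sum,
            ← Finset.add_sum_erase _ _ hα] at h4
          simp only [monomial_mul] at h4
          rw [Finset.sum_eq_zero fun β hβ => hk β hβ b hb, add_zero] at h4
          rw [add_comm, pow_succ, mul_right_comm]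
          exact h4
        rw [← Filter.map_add_atTop_eq_nat 1]
        exact h3
      have h2 : ∀ᶠ k in Filter.atTop, ∀ ν ∈ Finset.finsuppAntidiag (Finset.univ : Finset (Fin n)) D,
          ∀ b ∈ B ^ j, Φ.φ t (monomial ν (coeff α f ^ k * b)) = 0 := by
        rw [Filter.eventually_all_finset]
        intro ν hν
        exact h1 ν (Finset.mem_finsuppAntidiag.1 hν).1
      filter_upwards [h2] with k hk b hb ν hν
      exact hk ν (Finset.mem_finsuppAntidiag.2 ⟨hν, Finset.subset_univ _⟩) b hb
  obtain ⟨k, hk⟩ := (key 0 (Nat.zero_le _)).exists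
  exact ⟨k, by simpa using hk 1 (by simp)⟩

lemma exists_pow_le_killIdeal [IsNoetherianRing T] {m : Ideal T}
    (hm : (Ideal.span ((fun ν => coeff ν f) '' ↑f.support)).radical = m)
    {p : ℕ} (hf : f.IsHomogeneous p) {l t D : ℕ} (hlt : l + p ≤ t)
    (hD : D + l = n * t) : ∃ s, m ^ s ≤ Φ.killIdeal t D := by
  have h1 : ∀ α ∈ f.support, coeff α f ∈ (Φ.killIdeal t D).radical := by
    classical
    by_contra! h
    obtain ⟨α, hα, hmax⟩ := Finset.exists_max_image
      (f.support.filter fun α => coeff α f ∉ (Φ.killIdeal t D).radical) MonomialOrder.lex.toSyn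
      (by obtain ⟨α, h1, h2⟩ := h; exact ⟨α, Finset.mem_filter.2 ⟨h1, h2⟩⟩)
    rw [Finset.mem_filter] at hα
    obtain ⟨K, hK⟩ := Ideal.exists_pow_le_of_le_radical_of_fg
      (I := Ideal.span ((fun ν => coeff ν f) ''
        {β | β ∈ f.support ∧ MonomialOrder.lex.toSyn α < MonomialOrder.lex.toSyn β}))
      (J := Φ.killIdeal t D) (by
        rw [Ideal.span_le]
        rintro _ ⟨β, ⟨hβ, hlt⟩, rfl⟩
        by_contra hβ'
        exact absurd (hmax β (Finset.mem_filter.2 ⟨hβ, hβ'⟩)) (not_le.2 hlt))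
      (IsNoetherian.noetherian _)
    refine hα.2 (Φ.coeff_mem_radical_killIdeal hf hlt hD hα.1 (fun β hβ hlt => ?_) hK)
    exact Ideal.subset_span ⟨β, ⟨hβ, hlt⟩, rfl⟩
  refine Ideal.exists_pow_le_of_le_radical_of_fg ?_ (IsNoetherian.noetherian _)
  rw [← hm]
  refine Ideal.radical_le_radical_iff.2 (Ideal.span_le.2 ?_)
  rintro _ ⟨α, hα, rfl⟩
  exact h1 α hα

lemma exists_pow_smul_range_eq_zero [IsNoetherianRing T] {m : Ideal T}
    (hm : (Ideal.span ((fun ν => coeff ν f) '' ↑f.support)).radical = m)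
    {p : ℕ} (hf : f.IsHomogeneous p) (t : ℕ) :
    ∃ s, ∀ c ∈ m ^ s, ∀ g, Φ.φ t (C c * g) = 0 := by
  obtain ⟨s, hs⟩ := Φ.exists_pow_le_killIdeal hm hf (l := n * t) (t := t + (n * t + p))
    (D := n * (n * t + p)) (by omega) (by ring)
  refine ⟨s, fun c hc g => ?_⟩
  have h1 := hs hc (Finsupp.equivFunOnFinite.symm fun _ => n * t + p) (by simp)
  rw [← mul_one (monomial _ _), ← mul_one c, ← C_mul_monomial, ← prodX_pow, mul_assoc, φ_mul,
    Φ.map_add_mul, ← φ_mul] at h1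
  rw [mul_comm, φ_mul, ← mul_one (C c), h1, smul_zero]

end TopPresentation
end

section

open MvPolynomial
variable {T : Type} [CommRing T] {n : ℕ} {f : MvPolynomial (Fin n) T}
  {N : Type} [AddCommGroup N] [Module (MvPolynomial (Fin n) T) N]

lemma homogeneousComponent_mul_of_isHomogeneous_of_lt {g : MvPolynomial (Fin n) T} {i j : ℕ}
    (hg : g.IsHomogeneous i) (h : MvPolynomial (Fin n) T) (hij : j < i) :
    homogeneousComponent j (g * h) = 0 := by
  let := gradedAlgebra (σ := Fin n) (R := T)
  rw [← decomposition.decompose'_apply]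
  exact DirectSum.coe_decompose_mul_of_left_mem_of_not_le (homogeneousSubmodule (Fin n) T) hg
    (not_le.2 hij)

namespace TopPresentation
variable (Φ : TopPresentation f N)

lemma exists_forall_mem_range {P : Ideal (MvPolynomial (Fin n) T)}
    (hP : Module.Finite (MvPolynomial (Fin n) T) ((MvPolynomial (Fin n) T ⧸ P) →ₗ[
      MvPolynomial (Fin n) T] N)) :
    ∃ t, ∀ z : N, (∀ r ∈ P, r • z = 0) → z ∈ LinearMap.range (Φ.φ t) := by
  obtain ⟨G, hG⟩ := (Module.Finite.iff_fg (N := LinearMap.range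
    (LinearMap.applyₗ (R := MvPolynomial (Fin n) T) (M₂ := N)
      (Ideal.Quotient.mk P 1)))).1 inferInstance
  choose τ ρ hρ using Φ.exists_rep
  refine ⟨G.sup τ, fun z hz => ?_⟩
  have h1 : Submodule.span _ (G : Set N) ≤ LinearMap.range (Φ.φ (G.sup τ)) := by
    rw [Submodule.span_le]
    exact fun y hy => Φ.range_φ_mono (Finset.le_sup hy) ⟨ρ y, hρ y⟩
  refine h1 (hG ▸ ⟨P.liftQ (LinearMap.toSpanSingleton _ _ z) fun r hr => hz r hr, ?_⟩)
  exact one_smul _ z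

lemma φ_eq_zero_of_lt {p : ℕ} (hf : f.IsHomogeneous p) {t l e : ℕ} {g : MvPolynomial (Fin n) T}
    (hg : g.IsHomogeneous e) (h : Φ.φ t g ∈ LinearMap.range (Φ.φ l)) (hlt : e + n * l < n * t) :
    Φ.φ t g = 0 := by
  obtain ⟨h, hh⟩ := h
  obtain ⟨s, rfl⟩ : ∃ s, t = l + s :=
    Nat.exists_eq_add_of_le (lt_of_mul_lt_mul_left' (lt_of_le_of_lt (Nat.le_add_left _ _) hlt)).le
  rw [← Φ.map_add_mul l s, eq_comm, ← sub_eq_zero, ← map_sub] at hh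
  have h1 := Φ.φ_homogeneousComponent hf hh e
  rwa [map_sub, homogeneousComponent_mul_of_isHomogeneous_of_lt (prodX_pow_isHomogeneous s) h
    (by rw [mul_add] at hlt; omega), homogeneousComponent_eq_self hg, sub_zero] at h1

lemma φ_C_mul_eq_zero {p : ℕ} (hf : f.IsHomogeneous p) {m : Ideal T} {l s : ℕ}
    (hl : ∀ z : N, (∀ r ∈ m.map C ⊔ Ideal.span (Set.range (X : Fin n → MvPolynomial (Fin n) T)),
      r • z = 0) → z ∈ LinearMap.range (Φ.φ l))
    (hm : ∀ t, ∃ s, ∀ c ∈ m ^ s, ∀ g, Φ.φ t (C c * g) = 0)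
    (hs : ∀ c ∈ m ^ s, ∀ g, Φ.φ (n * l) (C c * g) = 0) {c : T} (hc : c ∈ m ^ s) (t : ℕ) {e : ℕ}
    {g : MvPolynomial (Fin n) T} (hg : g.IsHomogeneous e) : Φ.φ t (C c * g) = 0 := by
  rcases le_or_gt (n * t) (e + n * l) with h | h
  · obtain ⟨h, hh⟩ := Φ.φ_mem_range hg h
    rw [φ_mul, ← hh, ← φ_mul, hs c hc]
  have he : e ≤ n * t := by omega
  induction he using Nat.decreasingInduction generalizing g with
  | self => omega
  | of_succ e he ih =>
    have hX : ∀ i, Φ.φ t (C c * (X i * g)) = 0 := by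
      intro i
      have h1 : (X i * g).IsHomogeneous (e + 1) := by
        rw [add_comm]
        exact (isHomogeneous_X T i).mul hg
      rcases le_or_gt (n * t) (e + 1 + n * l) with h2 | h2
      · obtain ⟨h, hh⟩ := Φ.φ_mem_range h1 h2
        rw [φ_mul, ← hh, ← φ_mul, hs c hc]
      · exact ih h1 h2
    obtain ⟨k, hk⟩ := hm t
    have key : ∀ j ≤ k, ∀ y ∈ m ^ j, Φ.φ t (C y * (C c * g)) = 0 := by
      intro j hj
      induction hj using Nat.decreasingInduction with
      | self => exact fun y hy => hk y hy _
      | of_succ j hj ih =>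
        intro y hy
        refine Φ.φ_eq_zero_of_lt hf (e := e) ?_ (hl _ ?_) h
        · rw [← mul_assoc, ← C_mul]
          exact hg.C_mul _
        · have h1 : m.map C ⊔ Ideal.span (Set.range (X : Fin n → MvPolynomial (Fin n) T)) ≤
              LinearMap.ker (LinearMap.toSpanSingleton _ N (Φ.φ t (C y * (C c * g)))) := by
            refine sup_le (Ideal.span_le.2 ?_) (Ideal.span_le.2 ?_)
            · rintro _ ⟨a, ha, rfl⟩
              have h2 := ih (a * y) (by rw [pow_succ']; exact Ideal.mul_mem_mul ha hy)
              rwa [C_mul, mul_assoc, φ_mul] at h2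
            · rintro _ ⟨i, rfl⟩
              change (X i : MvPolynomial (Fin n) T) • Φ.φ t (C y * (C c * g)) = 0
              rw [← φ_mul, show X i * (C y * (C c * g)) = C y * (C c * (X i * g)) by ring, φ_mul,
                hX, smul_zero]
          exact fun r hr => h1 hr
    simpa using key 0 (Nat.zero_le _) 1 (by simp)

lemma exists_pow_φ_monomial_eq_zero [IsNoetherianRing T] {p : ℕ}
    (hf : f.IsHomogeneous p) {m : Ideal T}
    (hm : (Ideal.span ((fun ν => coeff ν f) '' ↑f.support)).radical = m)
    (hfin : Module.Finite (MvPolynomial (Fin n) T)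
      ((MvPolynomial (Fin n) T ⧸
        (m.map C ⊔ Ideal.span (Set.range (X : Fin n → MvPolynomial (Fin n) T)))) →ₗ[
      MvPolynomial (Fin n) T] N)) :
    ∃ s, ∀ c ∈ m ^ s, ∀ t ν, Φ.φ t (monomial ν c) = 0 := by
  obtain ⟨l, hl⟩ := Φ.exists_forall_mem_range hfin
  obtain ⟨s, hs⟩ := Φ.exists_pow_smul_range_eq_zero hm hf (n * l)
  refine ⟨s, fun c hc t ν => ?_⟩
  rw [← mul_one c, ← C_mul_monomial]
  exact Φ.φ_C_mul_eq_zero hf hl (Φ.exists_pow_smul_range_eq_zero hm hf) hs hc t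
    (isHomogeneous_monomial (1 : T) rfl)

end TopPresentation
end

section

open MvPolynomial

lemma sum_coeff_binomial_mul_eq_zero {A : Type} [CommRing A] {n : ℕ} {a b : A} (α β : Fin n →₀ ℕ)
    {q : ℕ} (ha : a ^ (q + 1) = 0) (hb : b ^ (q + 1) = 0) (u : Fin n →₀ ℕ)
    (h : MvPolynomial (Fin n) A) :
    ∑ j ∈ Finset.range (q + 1), (-1) ^ j * a ^ j * b ^ (q - j) *
      coeff ((q - j) • α + (j + 1) • β + u) ((monomial α a + monomial β b) * h) = 0 := by
  simp only [add_mul, coeff_add, mul_add, Finset.sum_add_distrib]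
  rw [Finset.sum_range_succ, Finset.sum_range_succ']
  have h1 : (-1) ^ q * a ^ q * b ^ (q - q) *
      coeff ((q - q) • α + (q + 1) • β + u) (monomial α a * h) = 0 := by
    rw [coeff_monomial_mul']
    split_ifs
    · rw [show (-1) ^ q * a ^ q * b ^ (q - q) * (a * coeff ((q - q) • α + (q + 1) • β + u - α) h) =
        (-1) ^ q * a ^ (q + 1) * b ^ (q - q) * coeff ((q - q) • α + (q + 1) • β + u - α) h by ring,
        ha]
      ring
    · exact mul_zero _
  have h2 : (-1) ^ 0 * a ^ 0 * b ^ (q - 0) *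
      coeff ((q - 0) • α + (0 + 1) • β + u) (monomial β b * h) = 0 := by
    rw [show (q - 0) • α + (0 + 1) • β + u = β + (q • α + u) by
      simp only [Nat.sub_zero, zero_add, one_smul]; abel, coeff_monomial_mul,
      show (-1) ^ 0 * a ^ 0 * b ^ (q - 0) * (b * coeff (q • α + u) h) =
        b ^ (q + 1) * coeff (q • α + u) h by simp; ring, hb, zero_mul]
  rw [h1, h2, add_zero, add_zero, ← Finset.sum_add_distrib]
  refine Finset.sum_eq_zero fun j hj => ?_
  obtain ⟨k, rfl⟩ := Nat.exists_eq_add_of_lt (Finset.mem_range.1 hj)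
  rw [show (j + k + 1 - j) • α + (j + 1) • β + u = α + (k • α + (j + 1) • β + u) by
      rw [show j + k + 1 - j = k + 1 by omega, succ_nsmul]; abel,
    show (j + k + 1 - (j + 1)) • α + (j + 1 + 1) • β + u = β + (k • α + (j + 1) • β + u) by
      rw [show j + k + 1 - (j + 1) = k by omega, succ_nsmul β (j + 1)]; abel,
    coeff_monomial_mul, coeff_monomial_mul, show j + k + 1 - j = k + 1 by omega,
    show j + k + 1 - (j + 1) = k by omega]
  ring

variable {T : Type} [CommRing T] {n : ℕ} {f : MvPolynomial (Fin n) T}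
  {N : Type} [AddCommGroup N] [Module (MvPolynomial (Fin n) T) N]

lemma map_eq_binomial {A : Type} [CommRing A] (ψ : T →+* A) {α β : Fin n →₀ ℕ} (hαβ : α ≠ β)
    (h : ∀ γ ∈ f.support, γ ≠ α → γ ≠ β → ψ (coeff γ f) = 0) :
    map ψ f = monomial α (ψ (coeff α f)) + monomial β (ψ (coeff β f)) := by
  classical
  ext γ
  rw [coeff_map, coeff_add, coeff_monomial, coeff_monomial]
  by_cases h1 : γ = α
  · subst h1; simp [hαβ.symm]
  by_cases h2 : γ = β
  · subst h2; simp [hαβ]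
  rw [if_neg (Ne.symm h1), if_neg (Ne.symm h2), add_zero]
  by_cases h3 : γ ∈ f.support
  · exact h γ h3 h1 h2
  · rw [notMem_support_iff.1 h3, map_zero]

lemma smul_add_smul_injective {α β : Fin n →₀ ℕ} (hαβ : α ≠ β) {q i j : ℕ} (hi : i ≤ q)
    (hj : j ≤ q) (h : (q - i) • α + (i + 1) • β = (q - j) • α + (j + 1) • β) : i = j := by
  obtain ⟨k, hk⟩ := Finsupp.ne_iff.1 hαβ
  have h1 := DFunLike.congr_fun h k
  simp only [Finsupp.add_apply, Finsupp.smul_apply, smul_eq_mul] at h1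
  zify [hi, hj] at h1 hk ⊢
  have h2 : ((i : ℤ) - j) * ((α k : ℤ) - β k) = 0 := by linear_combination -h1
  rcases mul_eq_zero.1 h2 with h3 | h3
  · omega
  · exact absurd (sub_eq_zero.1 h3) hk

namespace TopPresentation
variable (Φ : TopPresentation f N)

lemma map_mul_pow_mul_pow_eq_zero {p : ℕ} (hf : f.IsHomogeneous p) {α β : Fin n →₀ ℕ}
    (hα : α ∈ f.support) (hβ : β ∈ f.support) (hαβ : α ≠ β) {c : T}
    (hc : ∀ t ν, Φ.φ t (monomial ν c) = 0) {A : Type} [CommRing A] (ψ : T →+* A)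
    (h : ∀ γ ∈ f.support, γ ≠ α → γ ≠ β → ψ (coeff γ f) = 0) {q : ℕ}
    (ha : ψ (coeff α f) ^ (q + 1) = 0) (hb : ψ (coeff β f) ^ (q + 1) = 0) {j : ℕ} (hj : j ≤ q) :
    ψ c * (ψ (coeff α f) ^ j * ψ (coeff β f) ^ (q - j)) = 0 := by
  classical
  obtain ⟨w, hw⟩ := (Φ.eq_zero_iff _ _).1 (hc ((q + 1) * p + 1) ((q - j) • α + (j + 1) • β))
  obtain ⟨x, hx, y, hy, hxy⟩ := Submodule.mem_sup.1 hw
  obtain ⟨g, rfl⟩ := Ideal.mem_span_singleton.1 hy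
  set u : Fin n →₀ ℕ := Finsupp.equivFunOnFinite.symm fun _ => w
  have h1 := sum_coeff_binomial_mul_eq_zero α β ha hb u (map ψ g)
  have hx0 : ∀ i ≤ q, coeff ((q - i) • α + (i + 1) • β + u) x = 0 := by
    intro i hi
    by_contra h2
    obtain ⟨k, hk⟩ := (mem_powIdeal_iff _ x).1 hx _ (mem_support_iff.2 h2)
    have hle : ∀ γ ∈ f.support, γ k ≤ p := fun γ hγ => by
      rw [← sum_eq_of_isHomogeneous hf hγ]
      exact Finset.single_le_sum (fun _ _ => Nat.zero_le _) (Finset.mem_univ k)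
    have h3 := Nat.mul_le_mul_left (q - i) (hle α hα)
    have h4 := Nat.mul_le_mul_left (i + 1) (hle β hβ)
    have h5 : (q - i) * p + (i + 1) * p = (q + 1) * p := by
      rw [← add_mul, show q - i + (i + 1) = q + 1 by omega]
    have h6 : u k = w := rfl
    simp only [Finsupp.add_apply, Finsupp.smul_apply, smul_eq_mul] at hk
    omega
  rw [← map_eq_binomial ψ hαβ h, ← map_mul, eq_sub_of_add_eq' hxy, prodX_pow, monomial_mul, one_mul,
    Finset.sum_eq_single_of_mem j (Finset.mem_range.2 (by omega))] at h1
  · rw [coeff_map, coeff_sub, hx0 j hj, sub_zero, coeff_monomial, if_pos (add_comm _ _)] at h1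
    calc ψ c * (ψ (coeff α f) ^ j * ψ (coeff β f) ^ (q - j))
        = (-1) ^ j * ((-1) ^ j * ψ (coeff α f) ^ j * ψ (coeff β f) ^ (q - j) * ψ c) := by
          rw [show (-1 : A) ^ j * ((-1) ^ j * ψ (coeff α f) ^ j * ψ (coeff β f) ^ (q - j) * ψ c) =
            ((-1) ^ j * (-1) ^ j) * (ψ c * (ψ (coeff α f) ^ j * ψ (coeff β f) ^ (q - j))) by ring,
            ← mul_pow]
          simp
      _ = 0 := by rw [h1, mul_zero]
  · intro i hi hij
    have hi' : i ≤ q := Nat.lt_succ_iff.1 (Finset.mem_range.1 hi)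
    rw [coeff_map, coeff_sub, hx0 i hi', sub_zero, coeff_monomial, if_neg, map_zero, mul_zero]
    intro h2
    rw [add_comm, add_right_cancel_iff] at h2
    exact hij (smul_add_smul_injective hαβ hi' hj h2.symm)

end TopPresentation
end

section

lemma Ideal.sup_pow_succ_le {A : Type} [CommRing A] (I J : Ideal A) (r : ℕ) :
    (I ⊔ J) ^ (r + 1) ≤ I ^ (r + 1) ⊔ J * (I ⊔ J) ^ r := by
  induction r with
  | zero => simp
  | succ r ih =>
    rw [pow_succ', Ideal.sup_mul, sup_le_iff]
    refine ⟨(Ideal.mul_mono_right ih).trans ?_, le_sup_right⟩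
    rw [Ideal.mul_sup, ← pow_succ', mul_left_comm]
    refine sup_le_sup_left (Ideal.mul_mono_right ?_) _
    rw [pow_succ' _ r]
    exact Ideal.mul_mono_left le_sup_left

lemma Ideal.pow_add_eq_span_singleton_pow_mul {A : Type} [CommRing A] {Q : Ideal A} {b : A}
    {r : ℕ} (h : Q ^ (r + 1) = Ideal.span {b} * Q ^ r) (k : ℕ) :
    Q ^ (r + k) = Ideal.span {b ^ k} * Q ^ r := by
  induction k with
  | zero => simp
  | succ k ih =>
    rw [← add_assoc, pow_succ', ih, mul_left_comm, ← pow_succ', h, ← mul_assoc,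
      Ideal.span_singleton_mul_span_singleton, ← pow_succ]

open IsLocalRing

/-- A homogeneous relation with a unit coefficient produces a principal reduction. -/
lemma exists_pow_le_span_singleton_of_relation {A : Type} [CommRing A] [IsLocalRing A]
    [IsNoetherianRing A] (a b : A) {n r : ℕ} {t : ℕ → A} (hr : r ≤ n) (htr : IsUnit (t r))
    (h : ∑ i ∈ Finset.range (r + 1), t i * (a ^ i * b ^ (n - i)) ∈
      maximalIdeal A * Ideal.span {a, b} ^ n) :
    ∃ g ∈ Ideal.span {a, b}, ∃ N, Ideal.span {a, b} ^ N ≤ Ideal.span {g} := by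
  set φ := ∑ i ∈ Finset.range (r + 1), t i * (a ^ i * b ^ (r - i)) with hφ
  have hφn : ∑ i ∈ Finset.range (r + 1), t i * (a ^ i * b ^ (n - i)) = φ * b ^ (n - r) := by
    rw [hφ, Finset.sum_mul]
    refine Finset.sum_congr rfl fun i hi => ?_
    rw [show n - i = r - i + (n - r) by have := Finset.mem_range.1 hi; omega, pow_add]
    ring
  rw [hφn] at h
  have haQ : a ∈ Ideal.span {a, b} := Ideal.subset_span (by simp)
  have hbQ : b ∈ Ideal.span {a, b} := Ideal.subset_span (by simp)
  refine ⟨a * φ + b ^ (r + 1), Ideal.add_mem _ (Ideal.mul_mem_right _ _ haQ)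
    (Ideal.pow_mem_of_mem _ hbQ _ (Nat.succ_pos _)), r + (n + 1), ?_⟩
  set g := a * φ + b ^ (r + 1) with hg
  let π := Ideal.Quotient.mk (Ideal.span {g})
  let Q := (Ideal.span {a, b}).map π
  let m := (maximalIdeal A).map π
  have hQ : Q = Ideal.span {π a} ⊔ Ideal.span {π b} := by
    rw [← Ideal.span_insert, ← Set.image_pair, ← Ideal.map_span]
  have hπg : π a * π φ + π b ^ (r + 1) = 0 := by
    rw [← map_mul, ← map_pow, ← map_add]
    exact Ideal.Quotient.eq_zero_iff_mem.2 (Ideal.mem_span_singleton_self g)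
  have hb : π b ^ (n + 1) ∈ m * Q ^ (n + 1) := by
    have h1 : π b ^ (n + 1) = -π (a * (φ * b ^ (n - r))) := by
      rw [show n + 1 = (r + 1) + (n - r) by omega, pow_add, eq_neg_of_add_eq_zero_right hπg]
      simp only [map_mul, map_pow]
      ring
    rw [h1, neg_mem_iff, ← Ideal.map_pow, ← Ideal.map_mul, pow_succ', mul_left_comm]
    exact Ideal.mem_map_of_mem _ (Ideal.mul_mem_mul haQ h)
  have ha : π a ^ (r + 1) ∈ Ideal.span {π b} * Q ^ r := by
    have hbi : ∀ i ∈ Finset.range r, π a ^ (i + 1) * π b ^ (r - i) ∈ Ideal.span {π b} * Q ^ r := by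
      intro i hi
      rw [Finset.mem_range] at hi
      rw [show π a ^ (i + 1) * π b ^ (r - i) = π b * (π a ^ (i + 1) * π b ^ (r - (i + 1))) by
        rw [show r - i = r - (i + 1) + 1 by omega]; ring]
      refine Ideal.mul_mem_mul (Ideal.mem_span_singleton_self _) ?_
      have h1 := Ideal.mul_mem_mul (Ideal.pow_mem_pow (Ideal.mem_map_of_mem π haQ) (i + 1))
        (Ideal.pow_mem_pow (Ideal.mem_map_of_mem π hbQ) (r - (i + 1)))
      rwa [← pow_add, Nat.add_sub_cancel' hi] at h1
    rw [← Ideal.unit_mul_mem_iff_mem _ (htr.map π)]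
    have h1 : π (t r) * π a ^ (r + 1) =
        -(∑ i ∈ Finset.range r, π (t i) * (π a ^ (i + 1) * π b ^ (r - i)) + π b * π b ^ r) := by
      rw [← pow_succ', eq_neg_iff_add_eq_zero, ← hπg, hφ, Finset.sum_range_succ, map_add, map_sum,
        mul_add, Finset.mul_sum]
      simp only [map_mul, map_pow, Nat.sub_self, pow_zero, mul_one]
      rw [← add_assoc, add_comm (π (t r) * _)]
      congr 2
      · exact Finset.sum_congr rfl fun i _ => by ring
      · ring
    rw [h1, neg_mem_iff]
    refine Ideal.add_mem _ (Ideal.sum_mem _ fun i hi => Ideal.mul_mem_left _ _ (hbi i hi))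
      (Ideal.mul_mem_mul (Ideal.mem_span_singleton_self _) (Ideal.pow_mem_pow
        (Ideal.mem_map_of_mem π hbQ) r))
  have hQb : Q ^ (r + 1) = Ideal.span {π b} * Q ^ r := by
    refine le_antisymm ?_ ?_
    · have h1 := Ideal.sup_pow_succ_le (Ideal.span {π a}) (Ideal.span {π b}) r
      rw [← hQ, Ideal.span_singleton_pow] at h1
      exact h1.trans (sup_le ((Ideal.span_singleton_le_iff_mem _).2 ha) le_rfl)
    · rw [pow_succ', hQ]
      exact Ideal.mul_mono_left le_sup_right
  have hN : Q ^ (r + (n + 1)) ≤ m • Q ^ (r + (n + 1)) := by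
    conv_lhs => rw [Ideal.pow_add_eq_span_singleton_pow_mul hQb]
    rw [smul_eq_mul, add_comm r, pow_add Q, ← mul_assoc]
    exact Ideal.mul_mono_left ((Ideal.span_singleton_le_iff_mem _).2 hb)
  refine Submodule.le_of_le_smul_of_le_jacobson_bot (IsNoetherian.noetherian _)
    (maximalIdeal_le_jacobson ⊥) ?_
  rw [← Ideal.map_pow, smul_eq_mul, ← Ideal.map_mul, Ideal.map_le_iff_le_comap,
    Ideal.comap_map_quotientMk] at hN
  exact hN

lemma length_quotient_add_one_le {A : Type} [CommRing A] {I J : Ideal A} (h : I < J) :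
    Module.length A (A ⧸ J) + 1 ≤ Module.length A (A ⧸ I) := by
  rw [Module.length_quotient, Module.length_quotient]
  exact Order.coheight_add_one_le h

lemma length_quotient_anti {A : Type} [CommRing A] {I J : Ideal A} (h : I ≤ J) :
    Module.length A (A ⧸ J) ≤ Module.length A (A ⧸ I) := by
  rw [Module.length_quotient, Module.length_quotient]
  exact Order.coheight_anti h

lemma length_quotient_mul_sup_le {A : Type} [CommRing A] (x : A) (I K : Ideal A) :
    Module.length A (A ⧸ (Ideal.span {x} * I ⊔ K)) ≤
      Module.length A (A ⧸ (Ideal.span {x} ⊔ K)) + Module.length A (A ⧸ I) := by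
  let f : (A ⧸ I) →ₗ[A] A ⧸ (Ideal.span {x} * I ⊔ K) :=
    Submodule.mapQ I _ (LinearMap.mulLeft A x) fun y hy =>
      Ideal.mem_sup_left (Ideal.mul_mem_mul (Ideal.mem_span_singleton_self x) hy)
  let g : (A ⧸ (Ideal.span {x} * I ⊔ K)) →ₗ[A] A ⧸ (Ideal.span {x} ⊔ K) :=
    Submodule.factor (sup_le_sup_right Ideal.mul_le_left K)
  have hg : Function.Surjective g := Submodule.factor_surjective _
  rw [Module.length_eq_add_of_exact (LinearMap.ker g).subtype g (Submodule.subtype_injective _) hg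
    (LinearMap.exact_subtype_ker_map g), add_comm]
  have hfg : LinearMap.ker g ≤ LinearMap.range f := by
    intro z hz
    obtain ⟨y, rfl⟩ := Submodule.Quotient.mk_surjective _ z
    obtain ⟨y₁, h1, y₂, h2, rfl⟩ := Submodule.mem_sup.1 ((Submodule.Quotient.mk_eq_zero _).1 hz)
    obtain ⟨c, rfl⟩ := Ideal.mem_span_singleton.1 h1
    refine ⟨Submodule.Quotient.mk c, (Submodule.Quotient.eq _).2 ?_⟩
    rw [LinearMap.mulLeft_apply, sub_add_cancel_left]
    exact Ideal.mem_sup_right (neg_mem h2)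
  exact add_le_add_right ((Module.length_le_of_injective (Submodule.inclusion hfg)
    (Submodule.inclusion_injective hfg)).trans
    (Module.length_le_of_surjective f.rangeRestrict f.surjective_rangeRestrict)) _

lemma length_quotient_pow_add_le {A : Type} [CommRing A] [IsLocalRing A] [IsNoetherianRing A]
    {a b : A} (ha : a ∈ maximalIdeal A) (hb : b ∈ maximalIdeal A)
    (h : ∀ g ∈ Ideal.span {a, b}, ∀ N, ¬ Ideal.span {a, b} ^ N ≤ Ideal.span {g}) (n : ℕ) :
    Module.length A (A ⧸ Ideal.span {a, b} ^ n) + (n + 1 : ℕ) ≤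
      Module.length A (A ⧸ Ideal.span {a, b} ^ (n + 1)) := by
  set Q := Ideal.span {a, b} with hQ
  let e : ℕ → A := fun i => a ^ i * b ^ (n - i)
  let I : ℕ → Ideal A := fun k => maximalIdeal A * Q ^ n ⊔ Ideal.span (e '' (Finset.range k))
  have hI : ∀ k ≤ n, I k < I (k + 1) := by
    intro k hk
    refine lt_of_le_not_ge (sup_le_sup_left (Ideal.span_mono (Set.image_mono ?_)) _) fun hle => ?_
    · exact_mod_cast Finset.range_mono k.le_succ
    have h1 : e k ∈ I k := hle (Ideal.mem_sup_right (Ideal.subset_span ⟨k, by simp, rfl⟩))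
    obtain ⟨x, hx, y, hy, hxy⟩ := Submodule.mem_sup.1 h1
    obtain ⟨s, rfl⟩ := (Submodule.mem_span_image_finset_iff_exists_fun' A).1 hy
    obtain ⟨g, hg, N, hN⟩ := exists_pow_le_span_singleton_of_relation a b (n := n) (r := k)
      (t := fun i => if i = k then 1 else - s i) hk (by simp) (by
        rw [Finset.sum_range_succ, Finset.sum_congr rfl (g := fun i => -(s i * e i)) fun i hi => by
          rw [if_neg (Finset.mem_range.1 hi).ne, neg_mul], if_pos rfl, one_mul,
          Finset.sum_neg_distrib]
        change -_ + e k ∈ _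
        rw [← hxy]
        simpa using hx)
    exact h g hg N hN
  have hle : ∀ k ≤ n + 1, Module.length A (A ⧸ I k) + k ≤ Module.length A (A ⧸ I 0) := by
    intro k hk
    induction k with
    | zero => simp
    | succ k ih =>
      refine le_trans ?_ (ih (by omega))
      rw [Nat.cast_succ, add_comm (k : ℕ∞), ← add_assoc]
      exact add_le_add_left (length_quotient_add_one_le (hI k (by omega))) _
  have h0 : Q ^ (n + 1) ≤ I 0 := by
    rw [pow_succ']
    refine (Ideal.mul_mono_left ?_).trans le_sup_left
    rw [hQ, Ideal.span_le, Set.pair_subset_iff]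
    exact ⟨ha, hb⟩
  have hn : I (n + 1) ≤ Q ^ n := by
    refine sup_le Ideal.mul_le_right (Ideal.span_le.2 ?_)
    rintro _ ⟨i, hi, rfl⟩
    have h1 := Ideal.mul_mem_mul (Ideal.pow_mem_pow (I := Q) (x := a) (Ideal.subset_span (by simp)) i)
      (Ideal.pow_mem_pow (I := Q) (x := b) (Ideal.subset_span (by simp)) (n - i))
    rwa [← pow_add, Nat.add_sub_cancel' (by simpa [Nat.lt_succ_iff] using hi)] at h1
  exact (add_le_add_left (length_quotient_anti hn) _).trans
    ((hle (n + 1) le_rfl).trans (length_quotient_anti h0))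

lemma length_quotient_span_pow_le {A : Type} [CommRing A] (a b : A) (r : ℕ) :
    Module.length A (A ⧸ Ideal.span {a, b} ^ (2 * r)) ≤
      3 * Module.length A (A ⧸ Ideal.span {a ^ r, b ^ r}) := by
  set J := Ideal.span {a ^ r, b ^ r}
  have hJ : J = Ideal.span {b ^ r} ⊔ Ideal.span {a ^ r} := by
    rw [sup_comm, ← Ideal.span_insert]
  have h1 := length_quotient_mul_sup_le (a ^ r) J (Ideal.span {b ^ r} * J)
  have h2 := length_quotient_mul_sup_le (b ^ r) J (Ideal.span {a ^ r})
  rw [← hJ] at h2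
  rw [sup_comm (Ideal.span {a ^ r}), ← Ideal.sup_mul, sup_comm (Ideal.span {a ^ r}), ← hJ] at h1
  have h3 : J * J ≤ Ideal.span {a, b} ^ (2 * r) := by
    have h4 : J ≤ Ideal.span {a, b} ^ r := by
      rw [Ideal.span_le, Set.pair_subset_iff]
      exact ⟨Ideal.pow_mem_pow (Ideal.subset_span (by simp)) r,
        Ideal.pow_mem_pow (Ideal.subset_span (by simp)) r⟩
    rw [two_mul, pow_add]
    exact Ideal.mul_mono h4 h4
  calc _ ≤ _ := length_quotient_anti h3
    _ ≤ _ := h1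
    _ ≤ _ := add_le_add_left h2 _
    _ = _ := by ring

lemma false_of_quadratic_growth {h : ℕ → ℕ} (hmono : Monotone h)
    (hgrow : ∀ n, h n + (n + 1) ≤ h (n + 1)) (s : ℕ)
    (hdouble : ∀ q, h (2 * (q + 1)) ≤ 3 * h (q + s)) : False := by
  have h1 : ∀ n, n * n ≤ 2 * h n := by
    intro n
    induction n with
    | zero => simp
    | succ n ih =>
      have := hgrow n
      nlinarith
  have h2 : ∀ j, h (2 ^ j + 2 * s) ≤ 3 ^ j * h (1 + 2 * s) := by
    intro j
    induction j with
    | zero => simp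
    | succ j ih =>
      have h3 := hdouble (2 ^ j + s)
      rw [show 2 ^ j + s + s = 2 ^ j + 2 * s by ring] at h3
      have h4 : h (2 ^ (j + 1) + 2 * s) ≤ h (2 * (2 ^ j + s + 1)) := hmono (by rw [pow_succ]; omega)
      rw [pow_succ 3]
      linarith
  have h3 : ∀ j, (4 : ℝ) ^ j ≤ 3 ^ j * (2 * h (1 + 2 * s)) := by
    intro j
    have h4 := (h1 (2 ^ j)).trans (Nat.mul_le_mul_left 2 ((hmono (Nat.le_add_right _ (2 * s))).trans
      (h2 j)))
    rw [← mul_pow] at h4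
    have h5 : ((2 * 2 : ℕ) : ℝ) ^ j ≤ 2 * (3 ^ j * h (1 + 2 * s)) := by exact_mod_cast h4
    norm_num at h5
    linarith
  obtain ⟨j, hj⟩ := pow_unbounded_of_one_lt (2 * h (1 + 2 * s) : ℝ) (show (1 : ℝ) < 4 / 3 by norm_num)
  rw [div_pow, lt_div_iff₀ (by positivity), mul_comm] at hj
  exact absurd (h3 j) (not_le.2 hj)

lemma exists_not_pow_le_span_pow {A : Type} [CommRing A] [IsLocalRing A] [IsNoetherianRing A]
    {a b : A} (hab : (Ideal.span {a, b}).radical = maximalIdeal A)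
    (h : ∀ g, (Ideal.span {g}).radical ≠ maximalIdeal A) (s : ℕ) :
    ∃ q, ¬ Ideal.span {a, b} ^ (q + s) ≤ Ideal.span {a ^ (q + 1), b ^ (q + 1)} := by
  by_contra! hs
  have hQ : Ideal.span {a, b} ≤ maximalIdeal A := hab ▸ Ideal.le_radical
  have hrel : ∀ g ∈ Ideal.span {a, b}, ∀ N, ¬ Ideal.span {a, b} ^ N ≤ Ideal.span {g} := by
    intro g hg N hN
    refine h g (hab ▸ le_antisymm (Ideal.radical_mono ((Ideal.span_singleton_le_iff_mem _).2 hg)) ?_)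
    rw [Ideal.radical_le_radical_iff]
    exact fun x hx => ⟨N, hN (Ideal.pow_mem_pow hx N)⟩
  have hfin : ∀ n, Module.length A (A ⧸ Ideal.span {a, b} ^ n) ≠ ⊤ := by
    intro n
    refine ((length_quotient_anti (Ideal.pow_le_pow_right n.le_succ)).trans_lt ?_).ne
    have h1 : maximalIdeal A ∈ (Ideal.span {a, b} ^ (n + 1)).minimalPrimes := by
      rw [← Ideal.radical_minimalPrimes, Ideal.radical_pow _ n.succ_ne_zero, hab,
        Ideal.minimalPrimes_eq_subsingleton_self]
      rfl
    have := quotient_artinian_of_mem_minimalPrimes_of_isLocalRing _ h1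
    rw [Module.length_eq_of_surjective (R := A ⧸ Ideal.span {a, b} ^ (n + 1))
      Ideal.Quotient.mk_surjective]
    exact Module.length_ne_top.lt_top
  lift (fun n => Module.length A (A ⧸ Ideal.span {a, b} ^ n)) to ℕ → ℕ using hfin with ℓ hℓ
  replace hℓ : ∀ n, Module.length A (A ⧸ Ideal.span {a, b} ^ n) = ℓ n := fun n =>
    (congrFun hℓ n).symm
  refine false_of_quadratic_growth (h := ℓ) (fun i j hij => ?_) (fun n => ?_) s fun q => ?_
  · have h1 := length_quotient_anti (Ideal.pow_le_pow_right (I := Ideal.span {a, b}) hij)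
    rw [hℓ, hℓ] at h1
    exact_mod_cast h1
  · have h1 := length_quotient_pow_add_le (hQ (Ideal.subset_span (by simp)))
      (hQ (Ideal.subset_span (by simp))) hrel n
    rw [hℓ, hℓ] at h1
    exact_mod_cast h1
  · have h1 := (length_quotient_span_pow_le a b (q + 1)).trans
      (mul_le_mul_right (length_quotient_anti (hs q)) 3)
    rw [hℓ, hℓ] at h1
    exact_mod_cast h1

end

section

open IsLocalRing

lemma Ideal.span_pair_pow_le {A : Type} [CommRing A] (a b : A) (q : ℕ) :
    Ideal.span {a, b} ^ q ≤ Ideal.span ((fun j => a ^ j * b ^ (q - j)) '' Set.Iic q) := by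
  induction q with
  | zero =>
    rw [pow_zero, Ideal.one_eq_top, top_le_iff, Ideal.eq_top_iff_one]
    exact Ideal.subset_span ⟨0, by simp, by simp⟩
  | succ q ih =>
    rw [pow_succ']
    refine (Ideal.mul_mono_right ih).trans ?_
    rw [Ideal.span_mul_span', Ideal.span_le]
    rintro _ ⟨x, hx, _, ⟨j, hj, rfl⟩, rfl⟩
    rw [Set.mem_Iic] at hj
    rcases hx with rfl | rfl
    · refine Ideal.subset_span ⟨j + 1, by simpa using hj, ?_⟩
      simp only [Nat.add_sub_add_right]
      ring
    · refine Ideal.subset_span ⟨j, Set.mem_Iic.2 (by omega), ?_⟩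
      simp only [show q + 1 - j = q - j + 1 by omega]
      ring

/-- Modulo all but two elements of a system of parameters, the remaining two generate an ideal
whose radical is the maximal ideal. -/
lemma radical_span_pair_quotient_eq_maximalIdeal {T : Type} [CommRing T] [IsLocalRing T]
    {S : Set T} {a b : T} {K : Ideal T} [IsLocalRing (T ⧸ K)]
    (hS : (Ideal.span S).radical = maximalIdeal T) (ha : a ∈ S) (hb : b ∈ S)
    (hK : ∀ x ∈ S, x = a ∨ x = b ∨ x ∈ K) :
    (Ideal.span {Ideal.Quotient.mk K a, Ideal.Quotient.mk K b}).radical =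
      maximalIdeal (T ⧸ K) := by
  have := IsLocalHom.of_surjective (Ideal.Quotient.mk K) Ideal.Quotient.mk_surjective
  have hSm : ∀ x ∈ S, Ideal.Quotient.mk K x ∈ maximalIdeal (T ⧸ K) := by
    intro x hx
    rw [← Ideal.mem_comap, maximalIdeal_comap, ← hS]
    exact Ideal.le_radical (Ideal.subset_span hx)
  refine le_antisymm ?_ fun x hx => ?_
  · rw [(maximalIdeal.isMaximal _).isPrime.radical_le_iff, Ideal.span_le, Set.pair_subset_iff]
    exact ⟨hSm a ha, hSm b hb⟩
  · obtain ⟨y, rfl⟩ := Ideal.Quotient.mk_surjective x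
    have hy : y ∈ (Ideal.span S).radical :=
      by
      rw [hS]
      exact (map_mem_nonunits_iff (Ideal.Quotient.mk K) y).1 hx
    obtain ⟨k, hk⟩ := hy
    refine ⟨k, ?_⟩
    rw [← map_pow, ← Ideal.mem_comap]
    refine Ideal.span_le.2 (fun z hz => ?_) hk
    rcases hK z hz with rfl | rfl | hz
    · exact Ideal.subset_span (by simp)
    · exact Ideal.subset_span (by simp)
    · rw [SetLike.mem_coe, Ideal.mem_comap, Ideal.Quotient.eq_zero_iff_mem.2 hz]
      exact zero_mem _

lemma radical_span_singleton_quotient_ne_maximalIdeal {T : Type} [CommRing T] [IsLocalRing T]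
    [IsNoetherianRing T] {s : Finset T} [IsLocalRing (T ⧸ Ideal.span (s : Set T))]
    (h : ((s.card + 1 : ℕ) : WithBot ℕ∞) < ringKrullDim T) (g : T ⧸ Ideal.span (s : Set T)) :
    (Ideal.span {g}).radical ≠ maximalIdeal _ := by
  classical
  intro hg
  obtain ⟨g, rfl⟩ := Ideal.Quotient.mk_surjective g
  have := IsLocalHom.of_surjective (Ideal.Quotient.mk (Ideal.span (s : Set T)))
    Ideal.Quotient.mk_surjective
  have h1 : (Ideal.span ((insert g s : Finset T) : Set T)).radical = maximalIdeal T := by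
    have h2 := congrArg (Ideal.comap (Ideal.Quotient.mk (Ideal.span (s : Set T)))) hg
    rw [IsLocalRing.maximalIdeal_comap (Ideal.Quotient.mk (Ideal.span (s : Set T))),
      Ideal.comap_radical, ← Set.image_singleton, ← Ideal.map_span,
      Ideal.comap_map_of_surjective' _ Ideal.Quotient.mk_surjective, Ideal.mk_ker,
      ← Ideal.span_union] at h2
    rw [← h2, Finset.coe_insert, Set.singleton_union]
  have h2 : maximalIdeal T ∈ (Ideal.span ((insert g s : Finset T) : Set T)).minimalPrimes := by
    rw [← Ideal.radical_minimalPrimes, h1, Ideal.minimalPrimes_eq_subsingleton_self]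
    rfl
  have h3 := Ideal.height_le_card_of_mem_minimalPrimes_span_finset h2
  rw [← IsLocalRing.maximalIdeal_height_eq_ringKrullDim] at h
  have h4 := h3.trans (Nat.cast_le.2 (Finset.card_insert_le g s))
  exact absurd h (not_lt.2 (by exact_mod_cast h4))

end

section

open MvPolynomial IsLocalRing
variable {T : Type} [CommRing T] {n : ℕ} {f : MvPolynomial (Fin n) T}
  {N : Type} [AddCommGroup N] [Module (MvPolynomial (Fin n) T) N]

lemma TopPresentation.map_pow_add_le_span (Φ : TopPresentation f N) {p : ℕ}
    (hf : f.IsHomogeneous p) {α β : Fin n →₀ ℕ} (hα : α ∈ f.support) (hβ : β ∈ f.support)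
    (hαβ : α ≠ β) {s : ℕ}
    (hs : ∀ c ∈ Ideal.span {coeff α f, coeff β f} ^ s, ∀ t ν, Φ.φ t (monomial ν c) = 0)
    {A : Type} [CommRing A] {π : T →+* A} (hπ : Function.Surjective π)
    (h : ∀ γ ∈ f.support, γ ≠ α → γ ≠ β → π (coeff γ f) = 0) (q : ℕ) :
    Ideal.span {π (coeff α f), π (coeff β f)} ^ (q + s) ≤
      Ideal.span {π (coeff α f) ^ (q + 1), π (coeff β f) ^ (q + 1)} := by
  have h1 : Ideal.span {π (coeff α f), π (coeff β f)} ^ s =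
      Ideal.map π (Ideal.span {coeff α f, coeff β f} ^ s) := by
    rw [Ideal.map_pow, Ideal.map_span, Set.image_pair]
  rw [pow_add]
  refine (Ideal.mul_mono_left (Ideal.span_pair_pow_le _ _ q)).trans (Ideal.mul_le.2 ?_)
  intro x hx y hy
  rw [h1] at hy
  obtain ⟨c, hc, rfl⟩ := (Ideal.mem_map_iff_of_surjective π hπ).1 hy
  have hJ := fun z (hz : z ∈ Ideal.span {π (coeff α f) ^ (q + 1), π (coeff β f) ^ (q + 1)}) =>
    Ideal.Quotient.eq_zero_iff_mem.2 hz
  set ρ := Ideal.Quotient.mk (Ideal.span {π (coeff α f) ^ (q + 1), π (coeff β f) ^ (q + 1)})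
  induction hx using Submodule.span_induction with
  | mem x hx =>
    obtain ⟨j, hj, rfl⟩ := hx
    have h2 := Φ.map_mul_pow_mul_pow_eq_zero hf hα hβ hαβ (hs c hc) (ρ.comp π)
      (fun γ h3 h4 h5 => by simp [h γ h3 h4 h5])
      (by simpa only [map_pow, RingHom.comp_apply] using
        hJ (π (coeff α f) ^ (q + 1)) (Ideal.subset_span (by simp)))
      (by simpa only [map_pow, RingHom.comp_apply] using
        hJ (π (coeff β f) ^ (q + 1)) (Ideal.subset_span (by simp))) hj
    rw [mul_comm]
    refine Ideal.Quotient.eq_zero_iff_mem.1 ?_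
    simpa only [RingHom.comp_apply, map_mul, map_pow] using h2
  | zero => simp
  | add x y _ _ hx hy => rw [add_mul]; exact add_mem hx hy
  | smul a x _ hx => rw [smul_eq_mul, mul_assoc]; exact Ideal.mul_mem_left _ _ hx

end

open MvPolynomial

/-- **Marley–Vassilev, Main Theorem.**
Let `(T, m)` be a Noetherian local ring of Krull dimension `d ≥ 2`, let
`R = T[x₁,…,xₙ]` (`n ≥ 1`), `I = (x₁,…,xₙ)R`, and `P = mR + I` the homogeneous
maximal ideal of `R`.  If `f ∈ R` is homogeneous (of some degree `p`) and its
nonzero coefficients form a system of parameters for `T` (i.e. there are exactly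
`d = dim T` of them and they generate an `m`-primary ideal of `T`), then the
`*`socle `Hom_R(R/P, Hⁿ_I(R/fR))` is not a finitely generated `R`-module. -/
theorem socle_top_localCohomology_not_finite
    {T : Type} [CommRing T] [IsLocalRing T] [IsNoetherianRing T]
    (hd : 2 ≤ ringKrullDim T)
    (n : ℕ) (hn : 1 ≤ n)
    (f : MvPolynomial (Fin n) T) (p : ℕ) (hf : f.IsHomogeneous p)
    -- the nonzero coefficients of `f` form a system of parameters for `T`:
    (hsop_card : (f.support.card : WithBot (WithTop ℕ)) = ringKrullDim T)
    (hsop_coeff : ∀ m ∈ f.support, MvPolynomial.coeff m f ∈ IsLocalRing.maximalIdeal T)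
    (hsop_rad : (Ideal.span ((fun m => MvPolynomial.coeff m f) '' ↑f.support)).radical
        = IsLocalRing.maximalIdeal T) :
    letI R := MvPolynomial (Fin n) T
    letI I : Ideal R := Ideal.span (Set.range (X : Fin n → R))
    letI P : Ideal R := (IsLocalRing.maximalIdeal T).map (C : T →+* R) ⊔ I
    ¬ Module.Finite R
        ((R ⧸ P) →ₗ[R]
          ((localCohomology I n).obj (ModuleCat.of R (R ⧸ Ideal.span {f})))) := by
  intro hfin
  classical
  obtain ⟨Φ⟩ := nonempty_topPresentation hn f
  obtain ⟨s, hs⟩ := Φ.exists_pow_φ_monomial_eq_zero hf hsop_rad hfin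
  replace hsop_card : (f.support.card : WithBot ℕ∞) = ringKrullDim T := hsop_card
  have hcard : 2 ≤ f.support.card := by
    rw [← hsop_card] at hd
    exact_mod_cast hd
  obtain ⟨α, hα, β, hβ, hαβ⟩ := Finset.one_lt_card.1 hcard
  set S : Finset T := ((f.support.erase α).erase β).image fun γ => coeff γ f
  have hSm : Ideal.span (S : Set T) ≤ IsLocalRing.maximalIdeal T := by
    rw [Ideal.span_le]
    intro x hx
    obtain ⟨γ, hγ, rfl⟩ := Finset.mem_image.1 hx
    exact hsop_coeff γ (Finset.mem_of_mem_erase (Finset.mem_of_mem_erase hγ))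
  have hSγ : ∀ γ ∈ f.support, γ ≠ α → γ ≠ β → coeff γ f ∈ Ideal.span (S : Set T) :=
    fun γ h1 h2 h3 => Ideal.subset_span (Finset.mem_image_of_mem _
      (Finset.mem_erase.2 ⟨h3, Finset.mem_erase.2 ⟨h2, h1⟩⟩))
  have : Nontrivial (T ⧸ Ideal.span (S : Set T)) := Ideal.Quotient.nontrivial_iff.2
    (ne_top_of_le_ne_top Ideal.IsPrime.ne_top' hSm)
  have : IsLocalRing (T ⧸ Ideal.span (S : Set T)) := IsLocalRing.of_surjective'
    (Ideal.Quotient.mk _) Ideal.Quotient.mk_surjective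
  have hSd : ((S.card + 1 : ℕ) : WithBot ℕ∞) < ringKrullDim T := by
    rw [← hsop_card]
    have h1 : S.card ≤ f.support.card - 1 - 1 := by
      rw [← Finset.card_erase_of_mem hα,
        ← Finset.card_erase_of_mem (Finset.mem_erase.2 ⟨hαβ.symm, hβ⟩)]
      exact Finset.card_image_le
    exact_mod_cast show S.card + 1 < f.support.card by omega
  obtain ⟨q, hq⟩ := exists_not_pow_le_span_pow
    (radical_span_pair_quotient_eq_maximalIdeal (K := Ideal.span (S : Set T)) hsop_rad
      ⟨α, hα, rfl⟩ ⟨β, hβ, rfl⟩ (by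
        rintro _ ⟨γ, hγ, rfl⟩
        by_cases h1 : γ = α
        · exact Or.inl (h1 ▸ rfl)
        by_cases h2 : γ = β
        · exact Or.inr (Or.inl (h2 ▸ rfl))
        exact Or.inr (Or.inr (hSγ γ hγ h1 h2))))
    (radical_span_singleton_quotient_ne_maximalIdeal hSd) s
  refine hq (Φ.map_pow_add_le_span hf hα hβ hαβ (fun c hc => hs c (Ideal.pow_right_mono ?_ s hc))
    Ideal.Quotient.mk_surjective (fun γ h1 h2 h3 => Ideal.Quotient.eq_zero_iff_mem.2
      (hSγ γ h1 h2 h3)) q)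
  rw [Ideal.span_le, Set.pair_subset_iff]
  exact ⟨hsop_coeff α hα, hsop_coeff β hβ⟩
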